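/- arXiv:2303.11248 — 2 statements merged into one kernel-verified Lean document; each statement's English description precedes it below -/
import Mathlib

section
/- Let φ = p̃/p be a bidegree (m,n) rational inner function on 𝔻², and let α ∈ 𝕋 be a generic value for φ, with parameterizing functions g₁^α,…,g_n^α for C_α(φ) (no vertical lines occur for generic α). Then for every continuous function f on 𝕋², the Clark measure σ_α satisfies ∫_{𝕋²} f(ζ) dσ_α(ζ) = ∑_{j=1}^n ∫_𝕋 f(ζ, g_j^α(ζ)) |∂φ/∂z₂(ζ, g_j^α(ζ))|^{-1} dm(ζ). -/
open MeasureTheory Complex Filter Topology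

noncomputable section

/-- The open unit bidisk `𝔻²` in `ℂ²`. -/
def bidisk : Set (ℂ × ℂ) := {z | ‖z.1‖ < 1 ∧ ‖z.2‖ < 1}

/-- The closed bidisk. -/
def closedBidisk : Set (ℂ × ℂ) := {z | ‖z.1‖ ≤ 1 ∧ ‖z.2‖ ≤ 1}

/-- The distinguished boundary `𝕋²` of the bidisk. -/
def torus2 : Set (ℂ × ℂ) := {z | ‖z.1‖ = 1 ∧ ‖z.2‖ = 1}

/-- Evaluation of a two-variable polynomial at a point of `ℂ²`. -/
def ev (p : MvPolynomial (Fin 2) ℂ) (z : ℂ × ℂ) : ℂ :=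
  MvPolynomial.eval ![z.1, z.2] p

/-- The rational function `φ = p̃/p`. -/
def rif (p pt : MvPolynomial (Fin 2) ℂ) (z : ℂ × ℂ) : ℂ := ev pt z / ev p z

/-- The partial derivative `∂φ/∂z₁` of `φ = p̃/p`, via the quotient rule. -/
def dphi1 (p pt : MvPolynomial (Fin 2) ℂ) (z : ℂ × ℂ) : ℂ :=
  (ev (MvPolynomial.pderiv 0 pt) z * ev p z - ev pt z * ev (MvPolynomial.pderiv 0 p) z) /
    (ev p z) ^ 2

/-- The partial derivative `∂φ/∂z₂` of `φ = p̃/p`, via the quotient rule. -/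
def dphi2 (p pt : MvPolynomial (Fin 2) ℂ) (z : ℂ × ℂ) : ℂ :=
  (ev (MvPolynomial.pderiv 1 pt) z * ev p z - ev pt z * ev (MvPolynomial.pderiv 1 p) z) /
    (ev p z) ^ 2

/-- `pt` is the reflection `p̃(z₁,z₂) = z₁^m z₂^n conj(p(1/conj z₁, 1/conj z₂))` of `p`
at bidegree `(m,n)`. -/
def IsReflection2 (m n : ℕ) (p pt : MvPolynomial (Fin 2) ℂ) : Prop :=
  ∀ z : ℂ × ℂ, z.1 ≠ 0 → z.2 ≠ 0 →
    ev pt z = z.1 ^ m * z.2 ^ n *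
      (starRingEnd ℂ) (ev p (((starRingEnd ℂ) z.1)⁻¹, ((starRingEnd ℂ) z.2)⁻¹))

/-- The data of a bidegree `(m,n)` rational inner function `φ = p̃/p` on the bidisk
(with `m, n ≥ 1`):  `p` has degree `m` in `z₁` and `n` in `z₂`, is zero-free on `𝔻²`,
and has no common factor with its reflection `p̃`. -/
structure IsRIF2 (m n : ℕ) (p pt : MvPolynomial (Fin 2) ℂ) : Prop where
  hm : 1 ≤ m
  hn : 1 ≤ n
  deg1 : MvPolynomial.degreeOf 0 p = m
  deg2 : MvPolynomial.degreeOf 1 p = n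
  stable : ∀ z ∈ bidisk, ev p z ≠ 0
  coprime : ∀ r : MvPolynomial (Fin 2) ℂ, r ∣ p → r ∣ pt → IsUnit r
  reflection : IsReflection2 m n p pt

/-- The unimodular level set `C_α(φ)`, the closure of the set of points of `𝕋²` where
the radial limit of `φ` equals `α`. -/
def levelSet2 (p pt : MvPolynomial (Fin 2) ℂ) (α : ℂ) : Set (ℂ × ℂ) :=
  closure {ζ | ζ ∈ torus2 ∧
    Tendsto (fun r : ℝ => rif p pt ((r : ℂ) * ζ.1, (r : ℂ) * ζ.2))
      (𝓝[<] (1 : ℝ)) (𝓝 α)}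

/-- `α` is an exceptional value for `φ = p̃/p`: some horizontal or vertical line of `𝕋²`
is contained in `C_α(φ)`. -/
def IsExceptional (p pt : MvPolynomial (Fin 2) ℂ) (α : ℂ) : Prop :=
  ∃ τ : ℂ, ‖τ‖ = 1 ∧
    ({ζ : ℂ × ℂ | ζ.1 = τ ∧ ‖ζ.2‖ = 1} ⊆ levelSet2 p pt α ∨
     {ζ : ℂ × ℂ | ‖ζ.1‖ = 1 ∧ ζ.2 = τ} ⊆ levelSet2 p pt α)

/-- `α` is a generic value for `φ = p̃/p`. -/
def IsGenericValue (p pt : MvPolynomial (Fin 2) ℂ) (α : ℂ) : Prop :=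
  ¬ IsExceptional p pt α

/-- Normalized Lebesgue (arclength) measure on the unit circle, as a measure on `ℂ`. -/
def mCircle : Measure ℂ :=
  (ENNReal.ofReal (2 * Real.pi))⁻¹ •
    Measure.map (fun θ : ℝ => Complex.exp ((θ : ℂ) * Complex.I))
      (MeasureTheory.volume.restrict (Set.Ico 0 (2 * Real.pi)))

/-- The two-variable product Poisson kernel. -/
def poisson2 (z ζ : ℂ × ℂ) : ℝ :=
  ((1 - ‖z.1‖ ^ 2) / ‖ζ.1 - z.1‖ ^ 2) * ((1 - ‖z.2‖ ^ 2) / ‖ζ.2 - z.2‖ ^ 2)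

/-- `σ` is the Clark measure of `φ = p̃/p` at parameter `α`: a positive Borel measure
on `𝕋²` whose Poisson integral is `(1-|φ(z)|²)/|α-φ(z)|²`. -/
def IsClarkMeasure2 (p pt : MvPolynomial (Fin 2) ℂ) (α : ℂ) (σ : Measure (ℂ × ℂ)) : Prop :=
  σ torus2ᶜ = 0 ∧
  ∀ z ∈ bidisk,
    ∫⁻ ζ, ENNReal.ofReal (poisson2 z ζ) ∂σ =
      ENNReal.ofReal ((1 - ‖rif p pt z‖ ^ 2) / ‖α - rif p pt z‖ ^ 2)

/-- `g₁, …, g_n : 𝕋 → 𝕋` are functions on the circle, analytic except possibly at one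
base point `τ₀ ∈ 𝕋`. -/
def IsGraphFamily (n : ℕ) (g : Fin n → ℂ → ℂ) : Prop :=
  (∀ j, ∀ ζ : ℂ, ‖ζ‖ = 1 → ‖g j ζ‖ = 1) ∧
  ∃ τ₀ : ℂ, ‖τ₀‖ = 1 ∧ ∀ j, ∀ θ : ℝ,
    Complex.exp ((θ : ℂ) * Complex.I) ≠ τ₀ →
      AnalyticAt ℝ (fun t : ℝ => g j (Complex.exp ((t : ℂ) * Complex.I))) θ

/-- The union of the graphs `{(ζ, g_j(ζ)) : ζ ∈ 𝕋}`. -/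
def graphUnion (n : ℕ) (g : Fin n → ℂ → ℂ) : Set (ℂ × ℂ) :=
  ⋃ j, {w : ℂ × ℂ | ‖w.1‖ = 1 ∧ w.2 = g j w.1}

/-- The vertical line `{ζ ∈ 𝕋² : ζ₁ = τ}`. -/
def vLine (τ : ℂ) : Set (ℂ × ℂ) := {w : ℂ × ℂ | w.1 = τ ∧ ‖w.2‖ = 1}


open Polynomial in
lemma norm_eval_roots (P : ℂ[X]) (w : ℂ) :
    ‖P.eval w‖ = ‖P.leadingCoeff‖ * (P.roots.map (fun a => ‖w - a‖)).prod := by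
  have h := (IsAlgClosed.splits P).eq_prod_roots
  conv_lhs => rw [h]
  rw [eval_mul, eval_C, norm_mul, eval_multiset_prod, Multiset.map_map]
  congr 1
  have : ∀ s : Multiset ℂ, ‖(s.map ((fun p => eval w p) ∘ fun a => X - C a)).prod‖
      = (s.map (fun a => ‖w - a‖)).prod := by
    intro s
    induction s using Multiset.induction with
    | empty => simp
    | cons a s ih => simp only [Multiset.map_cons, Multiset.prod_cons, norm_mul, ih]; simp
  exact this _

lemma prod_le_aux (s : Multiset ℂ) (f g : ℂ → ℝ) (hf : ∀ a ∈ s, 0 ≤ f a)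
    (h : ∀ a ∈ s, f a ≤ g a) : (s.map f).prod ≤ (s.map g).prod ∧ 0 ≤ (s.map f).prod := by
  induction s using Multiset.induction with
  | empty => simp
  | cons a s ih =>
    obtain ⟨h1, h2⟩ := ih (fun b hb => hf b (Multiset.mem_cons_of_mem hb))
      (fun b hb => h b (Multiset.mem_cons_of_mem hb))
    have ha := hf a (Multiset.mem_cons_self a s)
    have hb := h a (Multiset.mem_cons_self a s)
    simp only [Multiset.map_cons, Multiset.prod_cons]
    exact ⟨mul_le_mul hb h1 h2 (ha.trans hb), mul_nonneg ha h2⟩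

open Polynomial in
/-- Quantitative Hurwitz. -/
lemma hurwitz_bound (P : ℂ[X]) (n : ℕ) (hn : P.natDegree ≤ n)
    (hz : ∀ w : ℂ, ‖w‖ < 1 → P.eval w ≠ 0) (w0 w : ℂ) (h0 : ‖w0‖ < 1) (hw : ‖w‖ ≤ 1) :
    ((1 - ‖w0‖) / 2) ^ n * ‖P.eval w‖ ≤ ‖P.eval w0‖ := by
  have hP0 : P ≠ 0 := by rintro rfl; exact hz 0 (by simp) (by simp)
  have hroot : ∀ a ∈ P.roots, 1 ≤ ‖a‖ := by
    intro a ha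
    by_contra! hlt
    exact hz a hlt (by simpa [hP0] using ha)
  set q := (1 - ‖w0‖) / 2 with hq
  have hq0 : 0 ≤ q := by rw [hq]; linarith
  have hq1 : q ≤ 1 := by rw [hq]; linarith [norm_nonneg w0]
  have hcard : Multiset.card P.roots ≤ n := P.card_roots'.trans hn
  rw [norm_eval_roots, norm_eval_roots]
  have key := (prod_le_aux P.roots (fun a => q * ‖w - a‖) (fun a => ‖w0 - a‖)
    (fun a _ => by positivity) (by
      intro a ha
      have h1 := hroot a ha
      have h2 : ‖w - a‖ ≤ 2 * ‖a‖ := by linarith [norm_sub_le w a]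
      have h3 : ‖a‖ - ‖w0‖ ≤ ‖w0 - a‖ := by
        rw [norm_sub_rev]; exact norm_sub_norm_le a w0
      have h4 : q * ‖w - a‖ ≤ q * (2 * ‖a‖) := by gcongr
      have : q * (2 * ‖a‖) = ‖a‖ - ‖w0‖ * ‖a‖ := by rw [hq]; ring
      nlinarith [norm_nonneg w0])).1
  have hpow : q ^ n ≤ q ^ (Multiset.card P.roots) := pow_le_pow_of_le_one hq0 hq1 hcard
  have e : (P.roots.map (fun a => q * ‖w - a‖)).prod
      = q ^ (Multiset.card P.roots) * (P.roots.map (fun a => ‖w - a‖)).prod := by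
    rw [Multiset.prod_map_mul]; simp
  rw [e] at key
  have hnn : 0 ≤ (P.roots.map (fun a => ‖w - a‖)).prod :=
    (prod_le_aux P.roots (fun a => ‖w - a‖) (fun a => ‖w - a‖) (fun _ _ => norm_nonneg _)
      (fun _ _ => le_rfl)).2
  calc q ^ n * (‖P.leadingCoeff‖ * (P.roots.map (fun a => ‖w - a‖)).prod)
      = ‖P.leadingCoeff‖ * (q ^ n * (P.roots.map (fun a => ‖w - a‖)).prod) := by ring
    _ ≤ ‖P.leadingCoeff‖ * (q ^ (Multiset.card P.roots) * (P.roots.map (fun a => ‖w - a‖)).prod) := by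
        gcongr
    _ ≤ _ := by gcongr

lemma norm_reflect_aux (w a : ℂ) (hw0 : w ≠ 0) :
    ‖w‖ * ‖((starRingEnd ℂ) w)⁻¹ - a‖ = ‖1 - (starRingEnd ℂ) w * a‖ := by
  have hc : (starRingEnd ℂ) w ≠ 0 := by simpa using hw0
  rw [← Complex.norm_conj w, ← norm_mul, mul_sub, mul_inv_cancel₀ hc]

lemma normSq_reflect_aux (w a : ℂ) :
    ‖1 - (starRingEnd ℂ) w * a‖ ^ 2 = ‖w - a‖ ^ 2 + (1 - ‖w‖ ^ 2) * (1 - ‖a‖ ^ 2) := by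
  simp only [← Complex.normSq_eq_norm_sq, Complex.normSq_apply]
  simp
  ring

open Polynomial in
lemma reflect_bound (P : ℂ[X]) (n : ℕ) (hn : P.natDegree ≤ n)
    (hz : ∀ w : ℂ, ‖w‖ < 1 → P.eval w ≠ 0) (w : ℂ) (hw0 : w ≠ 0) (hw : ‖w‖ < 1) :
    ‖w‖ ^ n * ‖P.eval ((starRingEnd ℂ) w)⁻¹‖ ≤ ‖P.eval w‖ := by
  have hP0 : P ≠ 0 := by rintro rfl; exact hz 0 (by simp) (by simp)
  have hroot : ∀ a ∈ P.roots, 1 ≤ ‖a‖ := by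
    intro a ha
    by_contra! hlt
    exact hz a hlt (by simpa [hP0] using ha)
  have hcard : Multiset.card P.roots ≤ n := P.card_roots'.trans hn
  rw [norm_eval_roots, norm_eval_roots]
  have key := (prod_le_aux P.roots (fun a => ‖w‖ * ‖((starRingEnd ℂ) w)⁻¹ - a‖) (fun a => ‖w - a‖)
    (fun a _ => by positivity) (by
      intro a ha
      have h1 := hroot a ha
      simp only [norm_reflect_aux w a hw0]
      apply le_of_sq_le_sq _ (norm_nonneg _) |>.trans le_rfl
      rw [normSq_reflect_aux]
      have : 0 ≤ (1 - ‖w‖^2) := by nlinarith [norm_nonneg w]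
      have h3 : 0 ≤ ‖a‖ ^ 2 - 1 := by nlinarith
      nlinarith [mul_nonneg this h3])).1
  have hpow : ‖w‖ ^ n ≤ ‖w‖ ^ (Multiset.card P.roots) :=
    pow_le_pow_of_le_one (norm_nonneg _) hw.le hcard
  rw [Multiset.prod_map_mul] at key
  simp only [Multiset.map_const', Multiset.prod_replicate] at key
  have hnn : 0 ≤ (P.roots.map (fun a => ‖((starRingEnd ℂ) w)⁻¹ - a‖)).prod :=
    (prod_le_aux P.roots (fun a => ‖((starRingEnd ℂ) w)⁻¹ - a‖) (fun a => ‖((starRingEnd ℂ) w)⁻¹ - a‖) (fun _ _ => norm_nonneg _)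
      (fun _ _ => le_rfl)).2
  calc ‖w‖ ^ n * (‖P.leadingCoeff‖ * (P.roots.map (fun a => ‖((starRingEnd ℂ) w)⁻¹ - a‖)).prod)
      = ‖P.leadingCoeff‖ * (‖w‖ ^ n * (P.roots.map (fun a => ‖((starRingEnd ℂ) w)⁻¹ - a‖)).prod) := by ring
    _ ≤ ‖P.leadingCoeff‖ * (‖w‖ ^ (Multiset.card P.roots) * (P.roots.map (fun a => ‖((starRingEnd ℂ) w)⁻¹ - a‖)).prod) := by
        gcongr
    _ ≤ _ := by gcongr

open Polynomial in
/-- `λ P'(λ)/P(λ)` has real part less than `n/2`. -/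
lemma logDeriv_re_lt (P : ℂ[X]) (n : ℕ) (hn1 : 1 ≤ n) (hn : P.natDegree ≤ n)
    (hz : ∀ w : ℂ, ‖w‖ ≤ 1 → P.eval w ≠ 0) (l : ℂ) (hl : ‖l‖ = 1) :
    2 * (l * (P.derivative.eval l / P.eval l)).re < n := by
  have hP0 : P ≠ 0 := by rintro rfl; exact hz 0 (by simp) (by simp)
  have hroot : ∀ a ∈ P.roots, 1 < ‖a‖ := by
    intro a ha
    by_contra! hlt
    exact hz a hlt (by simpa [hP0] using ha)
  have hcard : Multiset.card P.roots ≤ n := P.card_roots'.trans hn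
  rw [(IsAlgClosed.splits P).eval_derivative_div_eval_of_ne_zero (hz l hl.le)]
  have hl0 : l ≠ 0 := by rintro rfl; simp at hl
  have key : ∀ a : ℂ, 1 < ‖a‖ → 2 * (l * (1 / (l - a))).re < 1 := by
    intro a ha
    have hne : l - a ≠ 0 := by
      intro h; rw [sub_eq_zero] at h; rw [← h, hl] at ha; exact lt_irrefl _ ha
    have hpos : 0 < Complex.normSq (l - a) := Complex.normSq_pos.mpr hne
    have h1 : l.re * l.re + l.im * l.im = 1 := by
      rw [← Complex.normSq_apply, Complex.normSq_eq_norm_sq, hl]; norm_num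
    have h2 : 1 < a.re * a.re + a.im * a.im := by
      rw [← Complex.normSq_apply, Complex.normSq_eq_norm_sq]; nlinarith
    have : (l * (1 / (l - a))).re = (l.re * (l.re - a.re) + l.im * (l.im - a.im)) / Complex.normSq (l - a) := by
      rw [one_div, Complex.mul_re, Complex.inv_re, Complex.inv_im]
      simp; ring
    rw [this, mul_div_assoc', div_lt_one hpos, Complex.normSq_apply]
    simp only [Complex.sub_re, Complex.sub_im]
    nlinarith
  have : ∀ s : Multiset ℂ, (∀ a ∈ s, 1 < ‖a‖) →
      (2 * (l * (s.map (fun z => 1 / (l - z))).sum).re ≤ Multiset.card s ∧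
        (s ≠ 0 → 2 * (l * (s.map (fun z => 1 / (l - z))).sum).re < Multiset.card s)) := by
    intro s
    induction s using Multiset.induction with
    | empty => simp
    | cons a s ih =>
      intro h
      have h1 := (ih (fun b hb => h b (Multiset.mem_cons_of_mem hb))).1
      have h2 := key a (h a (Multiset.mem_cons_self a s))
      simp only [Multiset.map_cons, Multiset.sum_cons, Multiset.card_cons, mul_add, Complex.add_re]
      push_cast
      constructor
      · linarith
      · intro _; linarith
  obtain ⟨h1, h2⟩ := this P.roots hroot
  have hc : ((Multiset.card P.roots : ℕ) : ℝ) ≤ n := by exact_mod_cast hcard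
  by_cases h0 : P.roots = 0
  · rw [h0]; simp; omega
  · exact (h2 h0).trans_le hc

open Polynomial in
lemma reflect_poly (P Q : ℂ[X]) (n : ℕ) (c : ℂ) (hn : P.natDegree ≤ n)
    (hQ : ∀ w : ℂ, w ≠ 0 →
      Q.eval w = c * w ^ n * (starRingEnd ℂ) (P.eval ((starRingEnd ℂ) w)⁻¹)) :
    Q = C c * reflect n (P.map (starRingEnd ℂ)) := by
  refine eq_of_infinite_eval_eq _ _ ?_
  refine Set.Infinite.mono (s := {0}ᶜ) ?_ (Set.finite_singleton (0:ℂ)).infinite_compl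
  intro w hw
  have hw : w ≠ 0 := hw
  have hc : (starRingEnd ℂ) w ≠ 0 := by simpa using hw
  change eval w Q = eval w _
  rw [hQ w hw, eval_mul, eval_C, mul_assoc]
  congr 1
  let i : Invertible w := invertibleOfNonzero hw
  let i' : Invertible (w⁻¹) := invertibleOfNonzero (inv_ne_zero hw)
  have := eval₂_reflect_mul_pow (RingHom.id ℂ) (w⁻¹) n (P.map (starRingEnd ℂ))
    (natDegree_map_le.trans hn)
  have e : ⅟(w⁻¹) = w := by rw [invOf_eq_inv, inv_inv]
  rw [e] at this
  change eval w _ * _ = eval _ _ at this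
  have h2 : eval w⁻¹ (P.map (starRingEnd ℂ)) = (starRingEnd ℂ) (P.eval ((starRingEnd ℂ) w)⁻¹) := by
    conv_lhs => rw [show w⁻¹ = (starRingEnd ℂ) ((starRingEnd ℂ) w)⁻¹ by simp]
    rw [eval_map_apply]
  rw [← h2, ← this, inv_pow]
  field_simp

open Polynomial in
lemma deriv_reflect (P Q : ℂ[X]) (n : ℕ) (c : ℂ)
    (hQ : ∀ w : ℂ, w ≠ 0 →
      Q.eval w = c * w ^ n * (starRingEnd ℂ) (P.eval ((starRingEnd ℂ) w)⁻¹))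
    (l : ℂ) (hl : ‖l‖ = 1) :
    l * Q.derivative.eval l = n * Q.eval l
      - c * l ^ n * (starRingEnd ℂ) (l * P.derivative.eval l) := by
  have hl0 : l ≠ 0 := by rintro rfl; simp at hl
  have hinv : ((starRingEnd ℂ) l)⁻¹ = l := by
    rw [← Complex.inv_eq_conj hl, inv_inv]
  have hinv' : l⁻¹ = (starRingEnd ℂ) l := Complex.inv_eq_conj hl
  have hm : ∀ (A : ℂ[X]) (w : ℂ), eval w⁻¹ (A.map (starRingEnd ℂ)) = (starRingEnd ℂ) (A.eval ((starRingEnd ℂ) w)⁻¹) := by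
    intro A w
    conv_lhs => rw [show w⁻¹ = (starRingEnd ℂ) ((starRingEnd ℂ) w)⁻¹ by simp]
    rw [eval_map_apply]
  have h1 : HasDerivAt (fun w : ℂ => c * w ^ n * (P.map (starRingEnd ℂ)).eval w⁻¹)
      (c * (n * l ^ (n-1)) * (P.map (starRingEnd ℂ)).eval l⁻¹ +
        c * l ^ n * ((P.map (starRingEnd ℂ)).derivative.eval l⁻¹ * (-(l ^ 2)⁻¹))) l := by
    have a := (hasDerivAt_pow n l).const_mul c
    have b := ((P.map (starRingEnd ℂ)).hasDerivAt l⁻¹).comp l (hasDerivAt_inv hl0)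
    exact a.mul b
  have h2 : HasDerivAt (fun w : ℂ => Q.eval w) (Q.derivative.eval l) l := Q.hasDerivAt l
  have h3 : (fun w : ℂ => Q.eval w) =ᶠ[𝓝 l] (fun w : ℂ => c * w ^ n * (P.map (starRingEnd ℂ)).eval w⁻¹) := by
    filter_upwards [isOpen_ne.mem_nhds hl0] with w hw
    rw [hQ w hw, hm]
  have h4 := h2.unique (h1.congr_of_eventuallyEq h3)
  rw [h4, hQ l hl0, derivative_map, hm, hm, hinv, map_mul, ← hinv']
  rcases n with _ | n
  · simp; field_simp
  · simp only [Nat.add_sub_cancel]; push_cast; field_simp; ring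

open Polynomial in
/-- Angular derivative is positive. -/
lemma angular (P Q : ℂ[X]) (n : ℕ) (hn1 : 1 ≤ n) (c α : ℂ) (hα : ‖α‖ = 1)
    (hn : P.natDegree ≤ n)
    (hQ : ∀ w : ℂ, w ≠ 0 →
      Q.eval w = c * w ^ n * (starRingEnd ℂ) (P.eval ((starRingEnd ℂ) w)⁻¹))
    (hz : ∀ w : ℂ, ‖w‖ ≤ 1 → P.eval w ≠ 0)
    (l : ℂ) (hl : ‖l‖ = 1) (hlα : Q.eval l = α * P.eval l) :
    ∃ t : ℝ, 0 < t ∧ t = ‖(Q.derivative.eval l * P.eval l - Q.eval l * P.derivative.eval l) / (P.eval l) ^ 2‖ ∧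
      l * ((Q.derivative.eval l * P.eval l - Q.eval l * P.derivative.eval l) / (P.eval l) ^ 2) = α * t := by
  have hl0 : l ≠ 0 := by rintro rfl; simp at hl
  have hP := hz l hl.le
  have hα0 : α ≠ 0 := by rintro rfl; simp at hα
  have h1 := deriv_reflect P Q n c hQ l hl
  have h2 := logDeriv_re_lt P n hn1 hn hz l hl
  set t : ℝ := n - 2 * (l * (P.derivative.eval l / P.eval l)).re with ht
  have ht0 : 0 < t := by rw [ht]; linarith
  have hinv : ((starRingEnd ℂ) l)⁻¹ = l := by
    rw [← Complex.inv_eq_conj hl, inv_inv]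
  have hQl := hQ l hl0
  rw [hinv] at hQl
  have hcP : (starRingEnd ℂ) (P.eval l) ≠ 0 := by simpa using hP
  have hcl : c * l ^ n = α * P.eval l / (starRingEnd ℂ) (P.eval l) := by
    rw [eq_div_iff hcP, ← hQl, hlα]
  have htc : (t : ℂ) = n - (l * (P.derivative.eval l / P.eval l) + (starRingEnd ℂ) (l * (P.derivative.eval l / P.eval l))) := by
    rw [Complex.add_conj, ht]; push_cast; ring
  have key : l * ((Q.derivative.eval l * P.eval l - Q.eval l * P.derivative.eval l) / (P.eval l) ^ 2) = α * t := by
    rw [htc]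
    have : l * ((Q.derivative.eval l * P.eval l - Q.eval l * P.derivative.eval l) / (P.eval l) ^ 2)
      = ((l * Q.derivative.eval l) * P.eval l - Q.eval l * (l * P.derivative.eval l)) / (P.eval l)^2 := by ring
    rw [this, h1, hlα, hcl]
    simp only [map_mul, map_div₀]
    field_simp
    ring
  refine ⟨t, ht0, ?_, key⟩
  have := congrArg norm key
  rw [norm_mul, hl, one_mul, norm_mul, hα, one_mul, Complex.norm_real, Real.norm_of_nonneg ht0.le] at this
  exact this.symm

lemma circle_infinite : (Metric.sphere (0:ℂ) 1).Infinite := by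
  refine IsPreconnected.infinite_of_nontrivial ?_ ?_
  · exact isPreconnected_sphere (by simp [Complex.rank_real_complex]) 0 1
  · exact ⟨1, by simp, -1, by simp, by norm_num⟩

lemma re_herglotz_aux (α a b : ℂ) (hα : ‖α‖ = 1) :
    ((α * a + b) / (α * a - b)).re = (‖a‖ ^ 2 - ‖b‖ ^ 2) / ‖α * a - b‖ ^ 2 := by
  rw [Complex.div_re, ← add_div, Complex.normSq_eq_norm_sq]
  congr 1
  have h1 : α.re * α.re + α.im * α.im = 1 := by
    rw [← Complex.normSq_apply, Complex.normSq_eq_norm_sq, hα]; norm_num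
  simp only [← Complex.normSq_eq_norm_sq, Complex.normSq_apply]
  simp
  linear_combination (a.re ^ 2 + a.im ^ 2) * h1

lemma re_poisson_aux (s w : ℂ) (hs : ‖s‖ = 1) :
    ((s + w) / (s - w)).re = (1 - ‖w‖ ^ 2) / ‖s - w‖ ^ 2 := by
  have := re_herglotz_aux 1 s w (by simp)
  rw [one_mul, hs, one_pow] at this
  exact this

open Polynomial in
lemma clark_one (P Q : ℂ[X]) (n : ℕ) (hn1 : 1 ≤ n) (c α : ℂ) (hc : ‖c‖ = 1) (hα : ‖α‖ = 1)
    (hn : P.natDegree ≤ n)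
    (hQ : ∀ w : ℂ, w ≠ 0 →
      Q.eval w = c * w ^ n * (starRingEnd ℂ) (P.eval ((starRingEnd ℂ) w)⁻¹))
    (hz : ∀ w : ℂ, ‖w‖ ≤ 1 → P.eval w ≠ 0)
    (hR : ∀ w : ℂ, ‖w‖ < 1 → α * P.eval w - Q.eval w ≠ 0)
    (s : Fin n → ℂ) (hs1 : ∀ j, ‖s j‖ = 1) (hsα : ∀ j, Q.eval (s j) = α * P.eval (s j))
    (hsur : ∀ w : ℂ, ‖w‖ = 1 → Q.eval w = α * P.eval w → ∃ j, s j = w)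
    (w : ℂ) (hw : ‖w‖ < 1) :
    (‖P.eval w‖ ^ 2 - ‖Q.eval w‖ ^ 2) / ‖α * P.eval w - Q.eval w‖ ^ 2 =
      ∑ j, (1 - ‖w‖ ^ 2) / ‖s j - w‖ ^ 2 *
        ‖(Q.derivative.eval (s j) * P.eval (s j) - Q.eval (s j) * P.derivative.eval (s j)) / (P.eval (s j)) ^ 2‖⁻¹ := by
  have hα0 : α ≠ 0 := by rintro rfl; simp at hα
  have hc0 : c ≠ 0 := by rintro rfl; simp at hc
  have hcc : c * (starRingEnd ℂ) c = 1 := by rw [Complex.mul_conj, Complex.normSq_eq_norm_sq, hc]; simp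
  have hαα : α * (starRingEnd ℂ) α = 1 := by rw [Complex.mul_conj, Complex.normSq_eq_norm_sq, hα]; simp
  have hQp := reflect_poly P Q n c hn hQ
  set R : ℂ[X] := C α * P - Q with hRdef
  have hReval : ∀ w, R.eval w = α * P.eval w - Q.eval w := by intro w; simp [hRdef]
  have hQdeg : Q.natDegree ≤ n := by
    rw [hQp]
    refine (natDegree_C_mul_le _ _).trans (natDegree_reflect_le.trans ?_)
    exact max_le le_rfl (natDegree_map_le.trans hn)
  have hRdeg : R.natDegree ≤ n :=
    (natDegree_sub_le _ _).trans (max_le ((natDegree_C_mul_le _ _).trans hn) hQdeg)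
  have hQn : Q.coeff n = c * (starRingEnd ℂ) (P.coeff 0) := by
    rw [hQp, coeff_C_mul, coeff_reflect, coeff_map, revAt_le le_rfl, Nat.sub_self]
  have hQ0 : Q.coeff 0 = c * (starRingEnd ℂ) (P.coeff n) := by
    rw [hQp, coeff_C_mul, coeff_reflect, coeff_map, revAt_le (Nat.zero_le _), Nat.sub_zero]
  have hRn : R.coeff n ≠ 0 := by
    intro h0
    apply hR 0 (by simp)
    rw [← coeff_zero_eq_eval_zero, ← coeff_zero_eq_eval_zero, hQ0]
    have h1 : α * P.coeff n = c * (starRingEnd ℂ) (P.coeff 0) := by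
      rw [hRdef, coeff_sub, coeff_C_mul, hQn] at h0
      exact sub_eq_zero.mp h0
    have h2 := congrArg (starRingEnd ℂ) h1
    simp only [map_mul, Complex.conj_conj] at h2
    linear_combination (-(P.coeff 0) * α) * hcc - (α * c) * h2 + c * (starRingEnd ℂ) (P.coeff n) * hαα
  have hRdeg' : R.natDegree = n := le_antisymm hRdeg (le_natDegree_of_ne_zero hRn)
  have hR0 : R ≠ 0 := by intro h; rw [h] at hRn; simp at hRn
  have hlead : R.leadingCoeff ≠ 0 := by simpa using hR0
  -- roots lie on circle
  have hcirc : ∀ w, R.eval w = 0 → ‖w‖ = 1 := by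
    intro w h0
    rcases lt_trichotomy ‖w‖ 1 with h | h | h
    · exact absurd ((hReval w).symm.trans h0) (hR w h)
    · exact h
    · exfalso
      have hw0 : w ≠ 0 := by rintro rfl; simp at h; linarith
      have hwc : (starRingEnd ℂ) w ≠ 0 := by simpa using hw0
      set v := ((starRingEnd ℂ) w)⁻¹ with hv
      have hv0 : v ≠ 0 := inv_ne_zero hwc
      have hvw : ((starRingEnd ℂ) v)⁻¹ = w := by rw [hv]; simp
      apply hR v
      · rw [hv, norm_inv, Complex.norm_conj]; exact inv_lt_one_of_one_lt₀ h
      · have e1 := hQ v hv0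
        rw [hvw] at e1
        have e2 := hQ w hw0
        rw [← hv] at e2
        rw [hReval, e2] at h0
        have e3 := congrArg (starRingEnd ℂ) h0
        simp only [map_sub, map_mul, map_pow, Complex.conj_conj, map_zero] at e3
        have e4 : ((starRingEnd ℂ) w) ^ n * v ^ n = 1 := by
          rw [← mul_pow, hv, mul_inv_cancel₀ hwc, one_pow]
        rw [e1]
        linear_combination (-(α * c * v ^ n)) * e3 + c * v ^ n * (starRingEnd ℂ) (eval w P) * hαα
          - α * P.eval v * hcc - α * P.eval v * c * (starRingEnd ℂ) c * e4
  have hang : ∀ j, ∃ t : ℝ, 0 < t ∧ t = ‖(Q.derivative.eval (s j) * P.eval (s j) - Q.eval (s j) * P.derivative.eval (s j)) / (P.eval (s j)) ^ 2‖ ∧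
      s j * R.derivative.eval (s j) = - α * t * P.eval (s j) := by
    intro j
    obtain ⟨t, h1, h2, h3⟩ := angular P Q n hn1 c α hα hn hQ hz (s j) (hs1 j) (hsα j)
    refine ⟨t, h1, h2, ?_⟩
    have hP := hz (s j) (hs1 j).le
    rw [hsα j] at h3
    simp only [hRdef, derivative_sub, derivative_C_mul, eval_sub, eval_mul, eval_C]
    field_simp at h3
    linear_combination -h3
  choose t ht0 ht1 ht2 using hang
  have hRs : ∀ j, R.eval (s j) = 0 := by intro j; rw [hReval, hsα j, sub_self]
  have hsimple : R.roots.Nodup := by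
    rw [Multiset.nodup_iff_count_le_one]
    intro a
    rw [count_roots]
    by_contra! hlt
    rw [one_lt_rootMultiplicity_iff_isRoot hR0] at hlt
    have ha := hcirc a hlt.1
    have : Q.eval a = α * P.eval a := by
      have := hReval a; rw [hlt.1] at this; linear_combination this
    obtain ⟨j, rfl⟩ := hsur a ha this
    have h2 := ht2 j
    have h3 : eval (s j) (derivative R) = 0 := hlt.2
    rw [h3, mul_zero] at h2
    have : (t j : ℂ) ≠ 0 := by exact_mod_cast (ht0 j).ne'
    have hP := hz (s j) (hs1 j).le
    exact (mul_ne_zero (mul_ne_zero (neg_ne_zero.mpr hα0) this) hP) h2.symm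
  have hcardR : Multiset.card R.roots = n := by
    rw [← hRdeg']; exact (IsAlgClosed.splits R).natDegree_eq_card_roots.symm
  have hfin : R.roots.toFinset = Finset.univ.image s := by
    ext a
    simp only [Multiset.mem_toFinset, mem_roots hR0, Finset.mem_image, Finset.mem_univ, true_and]
    constructor
    · intro h
      have h' : R.eval a = 0 := h
      refine hsur a (hcirc a h') ?_
      have := hReval a; rw [h'] at this; linear_combination this
    · rintro ⟨j, rfl⟩; exact hRs j
  have hinj : Function.Injective s := by
    have h1 : (Finset.univ.image s).card = (Finset.univ : Finset (Fin n)).card := by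
      rw [← hfin, Multiset.toFinset_card_of_nodup hsimple, hcardR]; simp
    have := Finset.card_image_iff.mp h1
    simpa [Set.injOn_univ] using this
  have hroots : R.roots = (Finset.univ : Finset (Fin n)).val.map s := by
    rw [← Finset.image_val_of_injOn (hinj.injOn), ← hfin, Multiset.toFinset_val,
      Multiset.dedup_eq_self.mpr hsimple]
  have hRprod : R = C R.leadingCoeff * Lagrange.nodal Finset.univ s := by
    conv_lhs => rw [(IsAlgClosed.splits R).eq_prod_roots, hroots]
    rw [Multiset.map_map]; rfl
  set r := R.leadingCoeff with hr
  have hder : ∀ j, R.derivative.eval (s j) = r * (Lagrange.nodal (Finset.univ.erase j) s).eval (s j) := by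
    intro j
    rw [hRprod, derivative_C_mul, eval_mul, eval_C, Lagrange.eval_nodal_derivative_eval_node_eq (Finset.mem_univ j)]
  let G : ℂ[X] := ∑ j, C (-(r / t j)) * (C (s j) + X) * Lagrange.nodal (Finset.univ.erase j) s
  have hGdeg : G.natDegree ≤ n := by
    apply natDegree_sum_le_of_forall_le
    intro j _
    refine natDegree_mul_le.trans ?_
    have h1 : (C (-(r / t j)) * (C (s j) + X)).natDegree ≤ 1 := by
      refine (natDegree_C_mul_le _ _).trans ?_
      refine (natDegree_add_le _ _).trans ?_
      simp
    have h2 : (Lagrange.nodal (Finset.univ.erase j) s).natDegree = n - 1 := by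
      rw [Lagrange.natDegree_nodal, Finset.card_erase_of_mem (Finset.mem_univ j)]; simp
    omega
  have hGs : ∀ j, G.eval (s j) = 2 * α * P.eval (s j) := by
    intro j
    have : G.eval (s j) = -(r / t j) * (s j + s j) * (Lagrange.nodal (Finset.univ.erase j) s).eval (s j) := by
      simp only [G, eval_finsetSum]
      rw [Finset.sum_eq_single j]
      · simp
      · intro b _ hb
        rw [eval_mul, Lagrange.eval_nodal_at_node (by simp [hb.symm]), mul_zero]
      · simp
    rw [this]
    have h1 := ht2 j
    rw [hder j] at h1
    have : (t j : ℂ) ≠ 0 := by exact_mod_cast (ht0 j).ne'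
    field_simp
    linear_combination (-2) * h1
  let T : ℂ[X] := (C α * P + Q) - G
  have hTdeg : T.natDegree ≤ n :=
    (natDegree_sub_le _ _).trans (max_le ((natDegree_add_le _ _).trans
      (max_le ((natDegree_C_mul_le _ _).trans hn) hQdeg)) hGdeg)
  let κ : ℂ := T.coeff n / r
  let E : ℂ[X] := T - C κ * R
  have hEn : E.coeff n = 0 := by
    simp only [E, κ, coeff_sub, coeff_C_mul]
    have : R.coeff n = r := by rw [hr, leadingCoeff, hRdeg']
    rw [this, div_mul_cancel₀ _ hlead, sub_self]
  have hEdeg : E.natDegree ≤ n :=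
    (natDegree_sub_le _ _).trans (max_le hTdeg ((natDegree_C_mul_le _ _).trans hRdeg))
  have hE0 : E = 0 := by
    by_contra hne
    have hlt : E.natDegree < n := by
      refine lt_of_le_of_ne hEdeg ?_
      intro h
      have : E.leadingCoeff = 0 := by rw [leadingCoeff, h, hEn]
      exact hne (leadingCoeff_eq_zero.mp this)
    refine hne (eq_zero_of_natDegree_lt_card_of_eval_eq_zero E hinj ?_ (by simpa using hlt))
    intro j
    simp only [E, T, eval_sub, eval_add, eval_mul, eval_C, hRs, hGs, hsα]
    ring
  have hid : ∀ v : ℂ, (∀ j, s j ≠ v) →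
      (α * P.eval v + Q.eval v) / (α * P.eval v - Q.eval v) =
        κ + ∑ j, ((t j)⁻¹ : ℝ) * ((s j + v) / (s j - v)) := by
    intro v hv
    have hM : ∀ j, (Lagrange.nodal Finset.univ s).eval v = (v - s j) * (Lagrange.nodal (Finset.univ.erase j) s).eval v := by
      intro j
      rw [Lagrange.nodal_eq_mul_nodal_erase (Finset.mem_univ j)]; simp
    have hRv : R.eval v = r * (Lagrange.nodal Finset.univ s).eval v := by
      conv_lhs => rw [hRprod]
      simp
    have hRv0 : R.eval v ≠ 0 := by
      rw [hRv]
      refine mul_ne_zero hlead ?_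
      rw [Lagrange.eval_nodal, Finset.prod_ne_zero_iff]
      intro j _
      exact sub_ne_zero.mpr (hv j).symm
    have hEv : E.eval v = 0 := by rw [hE0]; simp
    have hGv : G.eval v = R.eval v * ∑ j, ((t j)⁻¹ : ℝ) * ((s j + v) / (s j - v)) := by
      simp only [G, eval_finsetSum, Finset.mul_sum]
      refine Finset.sum_congr rfl ?_
      intro j _
      have h1 : s j - v ≠ 0 := sub_ne_zero.mpr (hv j)
      have : (t j : ℂ) ≠ 0 := by exact_mod_cast (ht0 j).ne'
      rw [hRv, hM j]
      simp only [eval_mul, eval_add, eval_C, eval_X]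
      push_cast
      field_simp
      ring
    simp only [E, T, eval_sub, eval_add, eval_mul, eval_C] at hEv
    rw [← hReval, div_eq_iff hRv0]
    linear_combination hEv + hGv
  have hre : ∀ v : ℂ, (∀ j, s j ≠ v) →
      (‖P.eval v‖ ^ 2 - ‖Q.eval v‖ ^ 2) / ‖α * P.eval v - Q.eval v‖ ^ 2 =
      κ.re + ∑ j, (1 - ‖v‖ ^ 2) / ‖s j - v‖ ^ 2 * (t j)⁻¹ := by
    intro v hv
    rw [← re_herglotz_aux α _ _ hα, hid v hv, Complex.add_re, Complex.re_sum]
    congr 1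
    refine Finset.sum_congr rfl ?_
    intro j _
    rw [Complex.re_ofReal_mul, re_poisson_aux _ _ (hs1 j), mul_comm]
  have hκ : κ.re = 0 := by
    have hinf : (Metric.sphere (0:ℂ) 1).Infinite := circle_infinite
    obtain ⟨v, hv1, hv2⟩ := hinf.exists_notMem_finset (Finset.univ.image s)
    have hv1 : ‖v‖ = 1 := by simpa using hv1
    have hv0 : v ≠ 0 := by rintro rfl; simp at hv1
    have hv2 : ∀ j, s j ≠ v := by simpa using hv2
    have h := hre v hv2
    have hQv := hQ v hv0
    rw [← Complex.inv_eq_conj hv1, inv_inv] at hQv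
    have : ‖Q.eval v‖ = ‖P.eval v‖ := by rw [hQv]; simp [hc, hv1]
    simpa [this, hv1] using h.symm
  rw [hre w (by intro j h; rw [← h, hs1 j] at hw; exact lt_irrefl _ hw), hκ, zero_add]
  refine Finset.sum_congr rfl ?_
  intro j _
  rw [ht1 j]

open Polynomial in
lemma elim_aux (f g : ℂ[X][X]) (hf : f ≠ 0)
    (hcop : ∀ r : ℂ[X][X], r ∣ f → r ∣ g → IsUnit r) :
    ∃ h : ℂ[X], h ≠ 0 ∧ ∃ A B : ℂ[X][X], f * A + g * B = C h := by
  by_cases hd : f.natDegree ≠ 0 ∨ g.natDegree ≠ 0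
  · obtain ⟨A, B, -, -, hAB⟩ := exists_mul_add_mul_eq_C_resultant f g le_rfl le_rfl hd
    refine ⟨_, ?_, A, B, hAB⟩
    intro h0
    let K := FractionRing ℂ[X]
    have hinj : Function.Injective (algebraMap ℂ[X] K) := IsFractionRing.injective _ _
    have h1 : resultant (f.map (algebraMap ℂ[X] K)) (g.map (algebraMap ℂ[X] K)) = 0 := by
      rw [natDegree_map_eq_of_injective hinj, natDegree_map_eq_of_injective hinj,
        resultant_map_map, h0, map_zero]
    rw [resultant_eq_zero_iff] at h1
    apply h1.2
    let : NormalizedGCDMonoid ℂ[X] := Classical.choice inferInstance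
    set d := EuclideanDomain.gcd (f.map (algebraMap ℂ[X] K)) (g.map (algebraMap ℂ[X] K)) with hdd
    rw [← EuclideanDomain.gcd_isUnit_iff, ← hdd]
    have hf' : f.map (algebraMap ℂ[X] K) ≠ 0 := by
      rwa [Ne, Polynomial.map_eq_zero_iff hinj]
    have hd0 : d ≠ 0 := by
      intro h; rw [EuclideanDomain.gcd_eq_zero_iff] at h; exact hf' h.1
    obtain ⟨b, hb, hb2⟩ := IsLocalization.integerNormalization_spec (nonZeroDivisors ℂ[X]) d
    set e := IsLocalization.integerNormalization (nonZeroDivisors ℂ[X]) d with he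
    have hb0 : algebraMap ℂ[X] K b ≠ 0 := by
      rw [Ne, map_eq_zero_iff _ hinj]; exact nonZeroDivisors.ne_zero hb
    have hb3 : e.map (algebraMap ℂ[X] K) = C (algebraMap ℂ[X] K b) * d := by
      rw [hb2, ← smul_eq_C_mul, algebraMap_smul]
    have he0 : e ≠ 0 := by
      intro h
      rw [h, Polynomial.map_zero] at hb3
      exact mul_ne_zero (by simpa using hb0) hd0 hb3.symm
    have hu : IsUnit (C (algebraMap ℂ[X] K b)) := isUnit_C.mpr (isUnit_iff_ne_zero.mpr hb0)
    have hed : e.map (algebraMap ℂ[X] K) ∣ d := by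
      rw [hb3]; exact (hu.mul_left_dvd).mpr dvd_rfl
    have hpe : e.primPart.map (algebraMap ℂ[X] K) ∣ e.map (algebraMap ℂ[X] K) :=
      Polynomial.map_dvd _ e.primPart_dvd
    have hunit : IsUnit e.primPart := by
      apply hcop
      · exact e.isPrimitive_primPart.dvd_of_fraction_map_dvd_fraction_map (K := K)
          ((hpe.trans hed).trans (EuclideanDomain.gcd_dvd_left _ _))
      · exact e.isPrimitive_primPart.dvd_of_fraction_map_dvd_fraction_map (K := K)
          ((hpe.trans hed).trans (EuclideanDomain.gcd_dvd_right _ _))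
    have hcont : algebraMap ℂ[X] K e.content ≠ 0 := by
      rw [Ne, map_eq_zero_iff _ hinj, content_eq_zero_iff]; exact he0
    have hue : IsUnit (e.map (algebraMap ℂ[X] K)) := by
      rw [e.eq_C_content_mul_primPart, Polynomial.map_mul, Polynomial.map_C]
      exact (isUnit_C.mpr (isUnit_iff_ne_zero.mpr hcont)).mul (hunit.map (mapRingHom _))
    rw [hb3] at hue
    exact isUnit_of_mul_isUnit_right hue
  · push Not at hd
    obtain ⟨a, ha⟩ := natDegree_eq_zero.mp hd.1
    refine ⟨a, ?_, 1, 0, by simp [ha]⟩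
    rintro rfl
    exact hf (by simpa using ha.symm)

open Polynomial in
/-- as polynomial in second variable -/
def bi (p : MvPolynomial (Fin 2) ℂ) : ℂ[X][X] := (Bivariate.equivMvPolynomial ℂ).symm p

open Polynomial in
lemma ev_eq_bi (p : MvPolynomial (Fin 2) ℂ) (a b : ℂ) : ev p (a, b) = (bi p).evalEval a b := by
  have : (MvPolynomial.eval ![a, b]) = (evalEvalRingHom a b).comp
      ((Bivariate.equivMvPolynomial ℂ).symm : MvPolynomial (Fin 2) ℂ →+* ℂ[X][X]) := by
    apply MvPolynomial.ringHom_ext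
    · intro r; simp
    · intro i; fin_cases i <;> simp
  exact RingHom.congr_fun this p

open Polynomial in
lemma bi_coprime {m n : ℕ} {p pt : MvPolynomial (Fin 2) ℂ} (h : IsRIF2 m n p pt) :
    ∀ r : ℂ[X][X], r ∣ bi p → r ∣ bi pt → IsUnit r := by
  intro r h1 h2
  have e : ∀ q, Bivariate.equivMvPolynomial ℂ (bi q) = q := fun q => AlgEquiv.apply_symm_apply _ _
  have h1' := map_dvd (Bivariate.equivMvPolynomial ℂ) h1
  have h2' := map_dvd (Bivariate.equivMvPolynomial ℂ) h2
  rw [e] at h1' h2'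
  have := h.coprime _ h1' h2'
  exact (MulEquiv.isUnit_map (Bivariate.equivMvPolynomial ℂ)).mp this

lemma p_ne_zero {m n : ℕ} {p pt : MvPolynomial (Fin 2) ℂ} (h : IsRIF2 m n p pt) : p ≠ 0 := by
  rintro rfl
  exact h.stable (0, 0) (by simp [bidisk]) (by simp [ev])

open Polynomial in
lemma exists_good {m n : ℕ} {p pt : MvPolynomial (Fin 2) ℂ} (h : IsRIF2 m n p pt) :
    ∃ S : Set ℂ, S.Finite ∧ ∀ a ∉ S, ∀ b, ev p (a, b) = 0 → ev pt (a, b) = 0 → False := by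
  obtain ⟨k, hk, A, B, hAB⟩ := elim_aux (bi p) (bi pt)
    (by simpa [bi] using p_ne_zero h) (bi_coprime h)
  refine ⟨{a | k.eval a = 0}, ?_, ?_⟩
  · exact (k.roots.toFinset.finite_toSet).subset (by intro a ha; simpa [hk] using ha)
  · intro a ha b h1 h2
    apply ha
    rw [ev_eq_bi] at h1 h2
    have := congrArg (evalEval a b) hAB
    simpa [h1, h2, evalEval_C] using this.symm

open Polynomial in
lemma not_both_zero {m n : ℕ} {p pt : MvPolynomial (Fin 2) ℂ} (h : IsRIF2 m n p pt) (a : ℂ)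
    (h1 : ∀ b, ev p (a, b) = 0) (h2 : ∀ b, ev pt (a, b) = 0) : False := by
  have key : ∀ q : MvPolynomial (Fin 2) ℂ, (∀ b, ev q (a, b) = 0) → C (X - C a) ∣ bi q := by
    intro q hq
    rw [C_dvd_iff_dvd_coeff]
    intro i
    rw [dvd_iff_isRoot]
    have : (bi q).map (evalRingHom a) = 0 := by
      apply Polynomial.funext
      intro b
      rw [map_evalRingHom_eval, ← ev_eq_bi, hq]; simp
    have := congrArg (fun f => f.coeff i) this
    simpa using this
  have := bi_coprime h _ (key p h1) (key pt h2)
  rw [isUnit_C] at this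
  exact not_isUnit_X_sub_C a this

open Polynomial in
/-- slice polynomial -/
def slice (p : MvPolynomial (Fin 2) ℂ) (a : ℂ) : ℂ[X] := MvPolynomial.aeval ![C a, X] p

open Polynomial in
lemma slice_eval (p : MvPolynomial (Fin 2) ℂ) (a b : ℂ) : (slice p a).eval b = ev p (a, b) := by
  have : (MvPolynomial.eval ![a, b]) = (evalRingHom b).comp
      ((MvPolynomial.aeval ![C a, X] : MvPolynomial (Fin 2) ℂ →ₐ[ℂ] ℂ[X]) : MvPolynomial (Fin 2) ℂ →+* ℂ[X]) := by
    apply MvPolynomial.ringHom_ext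
    · intro r; simp
    · intro i; fin_cases i <;> simp
  exact (RingHom.congr_fun this p).symm

open Polynomial in
lemma slice_natDegree (p : MvPolynomial (Fin 2) ℂ) (a : ℂ) :
    (slice p a).natDegree ≤ MvPolynomial.degreeOf 1 p := by
  rw [slice, MvPolynomial.aeval_def, MvPolynomial.eval₂_eq']
  apply natDegree_sum_le_of_forall_le
  intro d hd
  rw [Fin.prod_univ_two]
  simp only [algebraMap_eq, Matrix.cons_val_zero, Matrix.cons_val_one]
  rw [← C_pow, ← mul_assoc, ← C_mul]
  refine (natDegree_C_mul_X_pow_le _ _).trans ?_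
  exact MvPolynomial.monomial_le_degreeOf 1 hd

open Polynomial in
lemma slice_derivative (p : MvPolynomial (Fin 2) ℂ) (a b : ℂ) :
    (slice p a).derivative.eval b = ev (MvPolynomial.pderiv 1 p) (a, b) := by
  rw [← slice_eval]
  congr 1
  induction p using MvPolynomial.induction_on with
  | C r => simp [slice]
  | add p q hp hq => simp only [slice, map_add] at *; rw [hp, hq]
  | mul_X p i hp =>
    simp only [slice, map_mul, derivative_mul, MvPolynomial.aeval_X, Derivation.leibniz, smul_eq_mul, map_add] at *
    rw [hp]
    fin_cases i <;> simp [MvPolynomial.pderiv_X] <;> ring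

open Polynomial in
/-- diagonal slice polynomial -/
def dslice (p : MvPolynomial (Fin 2) ℂ) (a b : ℂ) : ℂ[X] := MvPolynomial.aeval ![C a * X, C b * X] p

open Polynomial in
lemma dslice_eval (p : MvPolynomial (Fin 2) ℂ) (a b w : ℂ) :
    (dslice p a b).eval w = ev p (a * w, b * w) := by
  have : (MvPolynomial.eval ![a * w, b * w]) = (evalRingHom w).comp
      ((MvPolynomial.aeval ![C a * X, C b * X] : MvPolynomial (Fin 2) ℂ →ₐ[ℂ] ℂ[X]) : MvPolynomial (Fin 2) ℂ →+* ℂ[X]) := by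
    apply MvPolynomial.ringHom_ext
    · intro r; simp
    · intro i; fin_cases i <;> simp
  exact (RingHom.congr_fun this p).symm

open Polynomial in
lemma dslice_natDegree (p : MvPolynomial (Fin 2) ℂ) (a b : ℂ) :
    (dslice p a b).natDegree ≤ MvPolynomial.degreeOf 0 p + MvPolynomial.degreeOf 1 p := by
  rw [dslice, MvPolynomial.aeval_def, MvPolynomial.eval₂_eq']
  apply natDegree_sum_le_of_forall_le
  intro d hd
  rw [Fin.prod_univ_two]
  simp only [algebraMap_eq, Matrix.cons_val_zero, Matrix.cons_val_one]
  rw [mul_pow, mul_pow, ← C_pow, ← C_pow,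
    show C (MvPolynomial.coeff d p) * (C (a ^ d 0) * X ^ d 0 * (C (b ^ d 1) * X ^ d 1))
      = C (MvPolynomial.coeff d p * a ^ d 0 * b ^ d 1) * X ^ (d 0 + d 1) by
        simp only [C_mul, pow_add]; ring]
  refine (natDegree_C_mul_X_pow_le _ _).trans ?_
  exact add_le_add (MvPolynomial.monomial_le_degreeOf 0 hd) (MvPolynomial.monomial_le_degreeOf 1 hd)

lemma ev_continuous (p : MvPolynomial (Fin 2) ℂ) : Continuous (ev p) := by
  unfold ev
  refine (MvPolynomial.continuous_eval p).comp ?_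
  refine continuous_pi ?_
  intro i; fin_cases i
  · exact continuous_fst
  · exact continuous_snd

lemma ev_differentiable (p : MvPolynomial (Fin 2) ℂ) : Differentiable ℂ (ev p) := by
  induction p using MvPolynomial.induction_on with
  | C r => have : ev (MvPolynomial.C r) = fun _ => r := by ext z; simp [ev]
           rw [this]; fun_prop
  | add p q hp hq =>
    have : ev (p + q) = fun z => ev p z + ev q z := by ext z; simp [ev]
    rw [this]; exact hp.add hq
  | mul_X p i hp =>
    have : ev (p * MvPolynomial.X i) = fun z => ev p z * (![z.1, z.2] i) := by ext z; simp [ev]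
    rw [this]
    refine hp.mul ?_
    fin_cases i
    · exact differentiable_fst
    · exact differentiable_snd

lemma maxmod_aux (P Q : ℂ → ℂ) (hP : Differentiable ℂ P) (hQ : Differentiable ℂ Q) (ρ : ℝ)
    (hρ : 0 < ρ) (h0 : ∀ a, ‖a‖ ≤ ρ → P a ≠ 0) (hb : ∀ a, ‖a‖ = ρ → ‖Q a‖ ≤ ‖P a‖)
    (a : ℂ) (ha : ‖a‖ ≤ ρ) : ‖Q a‖ ≤ ‖P a‖ := by
  have hcl : closure (Metric.ball (0:ℂ) ρ) = Metric.closedBall 0 ρ := closure_ball _ hρ.ne'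
  have hd : DiffContOnCl ℂ (fun a => Q a / P a) (Metric.ball 0 ρ) := by
    apply DifferentiableOn.diffContOnCl
    rw [hcl]
    intro x hx
    exact ((hQ x).div (hP x) (h0 x (by simpa using hx))).differentiableWithinAt
  have := Complex.norm_le_of_forall_mem_frontier_norm_le (C := 1) Metric.isBounded_ball hd (by
    intro z hz
    rw [frontier_ball _ hρ.ne'] at hz
    have hz' : ‖z‖ = ρ := by simpa using hz
    rw [norm_div]
    exact div_le_one_of_le₀ (hb z hz') (norm_nonneg _)) (z := a) (by rw [hcl]; simpa using ha)
  rw [norm_div, div_le_one (norm_pos_iff.mpr (h0 a ha))] at this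
  exact this

lemma bound_diag {m n : ℕ} {p pt : MvPolynomial (Fin 2) ℂ} (h : IsRIF2 m n p pt) (a b : ℂ) (ρ : ℝ)
    (hρ : 0 < ρ) (hρ1 : ρ < 1) (ha : ‖a‖ = ρ) (hb : ‖b‖ = ρ) :
    ‖ev pt (a, b)‖ ≤ ‖ev p (a, b)‖ := by
  have ha0 : a ≠ 0 := by rintro rfl; simp at ha; linarith
  have hb0 : b ≠ 0 := by rintro rfl; simp at hb; linarith
  have hρc : (ρ : ℂ) ≠ 0 := by exact_mod_cast hρ.ne'
  have hn := dslice_natDegree p (a / ρ) (b / ρ)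
  rw [h.deg1, h.deg2] at hn
  have e1 : ∀ c : ℂ, ‖c‖ = ρ → c ≠ 0 → c / ρ * ((starRingEnd ℂ) (ρ:ℂ))⁻¹ = ((starRingEnd ℂ) c)⁻¹ := by
    intro c hc hc0
    have : c * (starRingEnd ℂ) c = ρ ^ 2 := by
      rw [Complex.mul_conj, Complex.normSq_eq_norm_sq, hc]; simp
    have h3 : (starRingEnd ℂ) c ≠ 0 := by simpa using hc0
    rw [Complex.conj_ofReal]
    field_simp
    exact this
  have key := reflect_bound (dslice p (a / ρ) (b / ρ)) (m + n) hn (by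
    intro w hw
    rw [dslice_eval]
    apply h.stable
    simp only [bidisk]
    constructor <;> simp [ha, hb, abs_of_pos hρ, hρ.ne', hw]) (ρ : ℂ) hρc (by simpa [abs_of_pos hρ] using hρ1)
  rw [dslice_eval, dslice_eval, e1 a ha ha0, e1 b hb hb0, div_mul_cancel₀ _ hρc, div_mul_cancel₀ _ hρc] at key
  rw [h.reflection (a, b) ha0 hb0]
  refine le_trans (le_of_eq ?_) key
  simp [ha, hb, abs_of_pos hρ, pow_add]

lemma bound_open {m n : ℕ} {p pt : MvPolynomial (Fin 2) ℂ} (h : IsRIF2 m n p pt) (a b : ℂ)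
    (ha : ‖a‖ < 1) (hb : ‖b‖ < 1) : ‖ev pt (a, b)‖ ≤ ‖ev p (a, b)‖ := by
  have d1 : ∀ (q : MvPolynomial (Fin 2) ℂ) (b : ℂ), Differentiable ℂ (fun a => ev q (a, b)) := fun q b =>
    (ev_differentiable q).comp (by fun_prop)
  have d2 : ∀ (q : MvPolynomial (Fin 2) ℂ) (a : ℂ), Differentiable ℂ (fun b => ev q (a, b)) := fun q a =>
    (ev_differentiable q).comp (by fun_prop)
  have A : ∀ a b : ℂ, ‖a‖ ≤ ‖b‖ → ‖b‖ < 1 → b ≠ 0 → ‖ev pt (a, b)‖ ≤ ‖ev p (a, b)‖ := by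
    intro a b hab hb hb0
    refine maxmod_aux (fun a => ev p (a, b)) (fun a => ev pt (a, b)) (d1 _ _) (d1 _ _) ‖b‖
      (norm_pos_iff.mpr hb0) ?_ ?_ a hab
    · intro a ha; exact h.stable _ ⟨lt_of_le_of_lt ha hb, hb⟩
    · intro a ha; exact bound_diag h a b ‖b‖ (norm_pos_iff.mpr hb0) hb ha rfl
  have B : ∀ a b : ℂ, ‖b‖ ≤ ‖a‖ → ‖a‖ < 1 → a ≠ 0 → ‖ev pt (a, b)‖ ≤ ‖ev p (a, b)‖ := by
    intro a b hab ha ha0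
    refine maxmod_aux (fun b => ev p (a, b)) (fun b => ev pt (a, b)) (d2 _ _) (d2 _ _) ‖a‖
      (norm_pos_iff.mpr ha0) ?_ ?_ b hab
    · intro b hb; exact h.stable _ ⟨ha, lt_of_le_of_lt hb ha⟩
    · intro b hb; exact bound_diag h a b ‖a‖ (norm_pos_iff.mpr ha0) ha rfl hb
  by_cases hb0 : b = 0
  · subst hb0
    by_cases ha0 : a = 0
    · subst ha0
      refine maxmod_aux (fun a => ev p (a, 0)) (fun a => ev pt (a, 0)) (d1 _ _) (d1 _ _) (1/2)
        (by norm_num) ?_ ?_ 0 (by simp)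
      · intro a ha; exact h.stable _ ⟨lt_of_le_of_lt ha (by norm_num), by simp⟩
      · intro a ha
        apply B
        · simp
        · rw [ha]; norm_num
        · rintro rfl; simp at ha
    · exact B _ _ (by simp) ha ha0
  · rcases le_total ‖a‖ ‖b‖ with hab | hab
    · exact A _ _ hab hb hb0
    · refine B _ _ hab ha ?_
      rintro rfl
      simp at hab; exact hb0 hab

lemma radial_tendsto (F : ℂ × ℂ → ℂ) (z : ℂ × ℂ) (hF : ContinuousAt F z) :
    Tendsto (fun r : ℝ => F ((r : ℂ) * z.1, (r : ℂ) * z.2)) (𝓝[<] (1 : ℝ)) (𝓝 (F z)) := by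
  have h1 : Tendsto (fun r : ℝ => ((r : ℂ) * z.1, (r : ℂ) * z.2)) (𝓝[<] (1 : ℝ)) (𝓝 z) := by
    have : Continuous (fun r : ℝ => ((r : ℂ) * z.1, (r : ℂ) * z.2)) := by fun_prop
    have := (this.tendsto 1).mono_left (nhdsWithin_le_nhds (s := Set.Iio 1))
    simpa using this
  exact hF.tendsto.comp h1

lemma radial_mem (z : ℂ × ℂ) (hz : z ∈ closedBidisk) :
    ∀ᶠ r : ℝ in 𝓝[<] (1 : ℝ), ((r : ℂ) * z.1, (r : ℂ) * z.2) ∈ bidisk := by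
  have : ∀ᶠ r : ℝ in 𝓝[<] (1 : ℝ), r ∈ Set.Ioo (0:ℝ) 1 := Ioo_mem_nhdsLT (by norm_num)
  filter_upwards [this] with r hr
  have e : ∀ c : ℂ, ‖c‖ ≤ 1 → ‖(r:ℂ) * c‖ < 1 := by
    intro c hc
    rw [norm_mul, Complex.norm_real, Real.norm_eq_abs, abs_of_pos hr.1]
    nlinarith [hr.1, hr.2, norm_nonneg c]
  exact ⟨e _ hz.1, e _ hz.2⟩

instance radial_neBot : (𝓝[<] (1 : ℝ)).NeBot := inferInstance

lemma bound_closed {m n : ℕ} {p pt : MvPolynomial (Fin 2) ℂ} (h : IsRIF2 m n p pt) (z : ℂ × ℂ)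
    (hz : z ∈ closedBidisk) : ‖ev pt z‖ ≤ ‖ev p z‖ := by
  have t1 := (radial_tendsto (ev pt) z (ev_continuous pt).continuousAt).norm
  have t2 := (radial_tendsto (ev p) z (ev_continuous p).continuousAt).norm
  refine le_of_tendsto_of_tendsto t1 t2 ?_
  filter_upwards [radial_mem z hz] with r hr
  exact bound_open h _ _ hr.1 hr.2

lemma levelSet_sub {m n : ℕ} {p pt : MvPolynomial (Fin 2) ℂ} (h : IsRIF2 m n p pt) (α : ℂ) :
    levelSet2 p pt α ⊆ {z | z ∈ torus2 ∧ ev pt z = α * ev p z} := by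
  unfold levelSet2
  apply closure_minimal
  · rintro z ⟨hz, ht⟩
    refine ⟨hz, ?_⟩
    have t1 := (radial_tendsto (ev pt) z (ev_continuous pt).continuousAt)
    have t2 := ht.mul (radial_tendsto (ev p) z (ev_continuous p).continuousAt)
    refine tendsto_nhds_unique t1 (t2.congr' ?_)
    filter_upwards [radial_mem z ⟨hz.1.le, hz.2.le⟩] with r hr
    rw [rif, div_mul_cancel₀ _ (h.stable _ hr)]
  · have c1 := ev_continuous p
    have c2 := ev_continuous pt
    have : IsClosed torus2 := by
      unfold torus2
      exact (isClosed_eq (by fun_prop) continuous_const).inter (isClosed_eq (by fun_prop) continuous_const)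
    exact this.inter (isClosed_eq c2 (by fun_prop))

lemma mem_levelSet {p pt : MvPolynomial (Fin 2) ℂ} (α : ℂ) (z : ℂ × ℂ) (hz : z ∈ torus2)
    (hp : ev p z ≠ 0) (hα : ev pt z = α * ev p z) : z ∈ levelSet2 p pt α := by
  apply subset_closure
  refine ⟨hz, ?_⟩
  have := radial_tendsto (rif p pt) z
    ((ev_continuous pt).continuousAt.div (ev_continuous p).continuousAt hp)
  rwa [show rif p pt z = α by rw [rif, hα, mul_div_cancel_right₀ _ hp]] at this

open Polynomial in
lemma R_slice_ne {m n : ℕ} {p pt : MvPolynomial (Fin 2) ℂ} (h : IsRIF2 m n p pt) (α : ℂ)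
    (g : Fin n → ℂ → ℂ) (hparam : levelSet2 p pt α = graphUnion n g) (ζ : ℂ) (hζ : ‖ζ‖ = 1)
    (hall : ∀ w, ‖w‖ < 1 → ev pt (ζ, w) = α * ev p (ζ, w)) : False := by
  have hall' : ∀ w, ev pt (ζ, w) = α * ev p (ζ, w) := by
    have : slice pt ζ = C α * slice p ζ := by
      apply Polynomial.eq_of_infinite_eval_eq
      apply ((infinite_of_mem_nhds (0:ℂ) (Metric.ball_mem_nhds 0 one_pos))).mono
      intro w hw
      have : ‖w‖ < 1 := by simpa using hw
      change eval w _ = eval w _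
      rw [eval_mul, eval_C, slice_eval, slice_eval]; exact hall w this
    intro w
    have := congrArg (eval w) this
    rwa [eval_mul, eval_C, slice_eval, slice_eval] at this
  have hp0 : slice p ζ ≠ 0 := by
    intro h0
    have : ∀ b, ev p (ζ, b) = 0 := by intro b; rw [← slice_eval, h0]; simp
    exact not_both_zero h ζ this (by intro b; rw [hall', this, mul_zero])
  have hfin : (Metric.sphere (0:ℂ) 1 ⊆ (slice p ζ).roots.toFinset ∪ Set.range (fun j => g j ζ)) := by
    intro w hw
    by_cases hw0 : ev p (ζ, w) = 0
    · left; simp [hp0, slice_eval, hw0]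
    · right
      have := mem_levelSet α (ζ, w) ⟨hζ, by simpa using hw⟩ hw0 (hall' w)
      rw [hparam, graphUnion] at this
      obtain ⟨j, hj⟩ := Set.mem_iUnion.mp this
      exact ⟨j, hj.2.symm⟩
  exact circle_infinite (((Finset.finite_toSet _).union (Set.finite_range _)).subset hfin)

lemma R_ne_open {m n : ℕ} {p pt : MvPolynomial (Fin 2) ℂ} (h : IsRIF2 m n p pt) (α : ℂ) (hα : ‖α‖ = 1)
    (g : Fin n → ℂ → ℂ) (hparam : levelSet2 p pt α = graphUnion n g) (z : ℂ × ℂ) (hz : z ∈ bidisk) :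
    α * ev p z - ev pt z ≠ 0 := by
  intro h0
  have hR : ev pt z = α * ev p z := (sub_eq_zero.mp h0).symm
  have hbd : bidisk = Metric.ball (0:ℂ) 1 ×ˢ Metric.ball (0:ℂ) 1 := by
    ext w; simp [bidisk]
  have hpre : IsPreconnected bidisk := by
    rw [hbd]
    exact ((convex_ball _ _).prod (convex_ball _ _)).isPreconnected
  have hop : IsOpen bidisk := by rw [hbd]; exact Metric.isOpen_ball.prod Metric.isOpen_ball
  have hd : DifferentiableOn ℂ (rif p pt) bidisk := fun w hw => by
    have e : rif p pt = fun w => ev pt w * (ev p w)⁻¹ := by ext w; rw [rif, div_eq_mul_inv]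
    rw [e]
    exact ((ev_differentiable pt w).mul
      ((ev_differentiable p w).inv (h.stable w hw))).differentiableWithinAt
  have hφz : rif p pt z = α := by rw [rif, hR, mul_div_cancel_right₀ _ (h.stable z hz)]
  have hmax : IsMaxOn (norm ∘ rif p pt) bidisk z := by
    intro w hw
    change ‖rif p pt w‖ ≤ ‖rif p pt z‖
    rw [hφz, hα, rif, norm_div]
    exact div_le_one_of_le₀ (bound_open h _ _ hw.1 hw.2) (norm_nonneg _)
  have heq := Complex.eqOn_of_isPreconnected_of_isMaxOn_norm hpre hop hd hz hmax
  have hin : ∀ w ∈ bidisk, ev pt w = α * ev p w := by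
    intro w hw
    have := heq hw
    rw [Function.const_apply, hφz] at this
    rwa [rif, div_eq_iff (h.stable w hw)] at this
  apply R_slice_ne h α g hparam 1 (by simp)
  intro w hw
  have t1 := radial_tendsto (ev pt) (1, w) (ev_continuous pt).continuousAt
  have t2 := (radial_tendsto (ev p) (1, w) (ev_continuous p).continuousAt).const_mul α
  refine tendsto_nhds_unique t1 (t2.congr' ?_)
  filter_upwards [radial_mem (1, w) ⟨by simp, hw.le⟩] with r hr
  exact (hin _ hr).symm

lemma R_ne {m n : ℕ} {p pt : MvPolynomial (Fin 2) ℂ} (h : IsRIF2 m n p pt) (α : ℂ) (hα : ‖α‖ = 1)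
    (g : Fin n → ℂ → ℂ) (hparam : levelSet2 p pt α = graphUnion n g) (a b : ℂ) (ha : ‖a‖ ≤ 1)
    (hb : ‖b‖ < 1) : α * ev p (a, b) - ev pt (a, b) ≠ 0 := by
  rcases lt_or_eq_of_le ha with ha | ha
  · exact R_ne_open h α hα g hparam (a, b) ⟨ha, hb⟩
  intro h0
  apply R_slice_ne h α g hparam a ha
  intro w hw
  set R : MvPolynomial (Fin 2) ℂ := MvPolynomial.C α * p - pt with hRd
  have hRe : ∀ z, ev R z = α * ev p z - ev pt z := by intro z; simp [ev, hRd]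
  have T : ∀ c : ℂ, Tendsto (fun r : ℝ => ev R ((r:ℂ) * a, c)) (𝓝[<] (1 : ℝ)) (𝓝 (ev R (a, c))) := by
    intro c
    have : Continuous (fun r : ℝ => ev R ((r:ℂ) * a, c)) := (ev_continuous R).comp (by fun_prop)
    have := (this.tendsto 1).mono_left (nhdsWithin_le_nhds (s := Set.Iio 1))
    simpa using this
  have hle := le_of_tendsto_of_tendsto ((T w).norm.const_mul (((1 - ‖b‖) / 2) ^ (MvPolynomial.degreeOf 1 R))) (T b).norm (by
    filter_upwards [radial_mem (a, 0) ⟨ha.le, by simp⟩] with r hr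
    have hr1 : ‖(r:ℂ) * a‖ < 1 := hr.1
    have := hurwitz_bound (slice R (r * a)) _ (slice_natDegree R (r * a)) (by
      intro w hw
      rw [slice_eval, hRe]
      exact R_ne_open h α hα g hparam _ ⟨hr1, hw⟩) b w hb hw.le
    rwa [slice_eval, slice_eval] at this)
  rw [hRe (a, b), h0, norm_zero] at hle
  have hpos : 0 < ((1 - ‖b‖) / 2) ^ (MvPolynomial.degreeOf 1 R) := by
    apply pow_pos; linarith
  have : ‖ev R (a, w)‖ = 0 := by
    by_contra hne
    have : 0 < ‖ev R (a, w)‖ := lt_of_le_of_ne (norm_nonneg _) (Ne.symm hne)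
    nlinarith [mul_pos hpos this]
  rw [norm_eq_zero, hRe] at this
  exact (sub_eq_zero.mp this).symm

lemma fibre_formula {m n : ℕ} {p pt : MvPolynomial (Fin 2) ℂ} (h : IsRIF2 m n p pt) (α : ℂ) (hα : ‖α‖ = 1)
    (g : Fin n → ℂ → ℂ) (hparam : levelSet2 p pt α = graphUnion n g) :
    ∃ S : Set ℂ, S.Finite ∧ ∀ ζ, ‖ζ‖ = 1 → ζ ∉ S → (∀ b, ‖b‖ ≤ 1 → ev p (ζ, b) ≠ 0) ∧
      ∀ w, ‖w‖ < 1 →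
      (‖ev p (ζ, w)‖ ^ 2 - ‖ev pt (ζ, w)‖ ^ 2) / ‖α * ev p (ζ, w) - ev pt (ζ, w)‖ ^ 2 =
      ∑ j, (1 - ‖w‖ ^ 2) / ‖g j ζ - w‖ ^ 2 * ‖dphi2 p pt (ζ, g j ζ)‖⁻¹ := by
  obtain ⟨S, hS, hgood⟩ := exists_good h
  refine ⟨S, hS, fun ζ hζ hζS => ?_⟩
  have hz : ∀ b, ‖b‖ ≤ 1 → ev p (ζ, b) ≠ 0 := by
    intro b hb h0
    have := bound_closed h (ζ, b) ⟨hζ.le, hb⟩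
    rw [h0, norm_zero, norm_le_zero_iff] at this
    exact hgood ζ hζS b h0 this
  refine ⟨hz, fun w hw => ?_⟩
  have hmem : ∀ j, (ζ, g j ζ) ∈ levelSet2 p pt α := by
    intro j; rw [hparam]; exact Set.mem_iUnion.mpr ⟨j, hζ, rfl⟩
  have hζ0 : ζ ≠ 0 := by rintro rfl; simp at hζ
  have := clark_one (slice p ζ) (slice pt ζ) n h.hn (ζ ^ m) α (by simp [hζ]) hα
    ((slice_natDegree p ζ).trans h.deg2.le) (by
      intro w hw
      rw [slice_eval, slice_eval, h.reflection (ζ, w) hζ0 hw]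
      have : ((starRingEnd ℂ) ζ)⁻¹ = ζ := by
        have : ζ * (starRingEnd ℂ) ζ = 1 := by
          rw [Complex.mul_conj, Complex.normSq_eq_norm_sq, hζ]; simp
        rw [eq_comm]; exact eq_inv_of_mul_eq_one_left this
      simp only [this])
    (by intro w hw; rw [slice_eval]; exact hz w hw)
    (by intro w hw; rw [slice_eval, slice_eval]; exact R_ne h α hα g hparam ζ w hζ.le hw)
    (fun j => g j ζ) (fun j => (levelSet_sub h α (hmem j)).1.2)
    (by intro j; rw [slice_eval, slice_eval]; exact (levelSet_sub h α (hmem j)).2)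
    (by
      intro w hw hw2
      rw [slice_eval, slice_eval] at hw2
      have := mem_levelSet α (ζ, w) ⟨hζ, hw⟩ (hz w hw.le) hw2
      rw [hparam] at this
      obtain ⟨j, hj⟩ := Set.mem_iUnion.mp this
      exact ⟨j, hj.2.symm⟩) w hw
  simp only [slice_eval, slice_derivative] at this
  exact this

/-- circle parametrisation -/
def cE (θ : ℝ) : ℂ := Complex.exp ((θ : ℂ) * Complex.I)

lemma cE_cont : Continuous cE := by unfold cE; fun_prop

lemma cE_norm (θ : ℝ) : ‖cE θ‖ = 1 := Complex.norm_exp_ofReal_mul_I θ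

lemma cE_countable (a : ℂ) : (cE ⁻¹' {a}).Countable := by
  by_cases h : (cE ⁻¹' {a}).Nonempty
  · obtain ⟨t, ht⟩ := h
    refine (Set.countable_range (fun k : ℤ => t + k * (2 * Real.pi))).mono ?_
    intro s hs
    have : Complex.exp ((s : ℂ) * Complex.I) = Complex.exp ((t : ℂ) * Complex.I) := by
      have h1 : cE s = a := hs
      have h2 : cE t = a := ht
      exact h1.trans h2.symm
    obtain ⟨k, hk⟩ := Complex.exp_eq_exp_iff_exists_int.mp this
    refine ⟨k, ?_⟩
    have h3 : (s : ℂ) = t + k * (2 * Real.pi) := by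
      have : (s : ℂ) * I = (t + k * (2 * Real.pi)) * I := by rw [hk]; ring
      exact mul_right_cancel₀ Complex.I_ne_zero this
    exact_mod_cast h3.symm
  · rw [Set.not_nonempty_iff_eq_empty] at h; rw [h]; exact Set.countable_empty

lemma mCircle_ae {P : ℂ → Prop} (hP : MeasurableSet {z | P z}) (h : ∀ᵐ θ : ℝ, P (cE θ)) :
    ∀ᵐ ζ ∂mCircle, P ζ := by
  unfold mCircle
  apply Measure.ae_smul_measure
  change ∀ᵐ ζ ∂(Measure.map cE _), P ζ
  rw [ae_map_iff cE_cont.aemeasurable hP]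
  exact ae_restrict_of_ae h

lemma mCircle_norm : ∀ᵐ ζ ∂mCircle, ‖ζ‖ = 1 := by
  apply mCircle_ae
  · exact (isClosed_eq continuous_norm continuous_const).measurableSet
  · exact Filter.Eventually.of_forall cE_norm

lemma mCircle_finite {S : Set ℂ} (hS : S.Finite) : ∀ᵐ ζ ∂mCircle, ζ ∉ S := by
  apply mCircle_ae
  · exact hS.measurableSet.compl
  · have : (cE ⁻¹' S).Countable := by
      rw [← Set.biUnion_preimage_singleton]
      exact hS.countable.biUnion (fun a _ => cE_countable a)
    exact this.ae_notMem _

instance mCircle_isFinite : IsFiniteMeasure mCircle := by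
  unfold mCircle
  constructor
  rw [Measure.smul_apply, Measure.map_apply (by fun_prop) MeasurableSet.univ, smul_eq_mul]
  apply ENNReal.mul_lt_top
  · simp [Real.pi_pos]
  · exact measure_lt_top _ _

lemma mCircle_integral {E : Type*} [NormedAddCommGroup E] [NormedSpace ℝ E] (f : ℂ → E)
    (hf : AEStronglyMeasurable f mCircle) : ∫ ζ, f ζ ∂mCircle = Real.circleAverage f 0 1 := by
  have h2 : (ENNReal.ofReal (2 * Real.pi)) ≠ ⊤ := ENNReal.ofReal_ne_top
  have hf' : AEStronglyMeasurable f (Measure.map cE (volume.restrict (Set.Ico 0 (2 * Real.pi)))) := by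
    refine hf.mono_ac ?_
    unfold mCircle
    refine Measure.AbsolutelyContinuous.smul_right Measure.AbsolutelyContinuous.rfl ?_
    exact ENNReal.inv_ne_zero.mpr h2
  unfold mCircle
  rw [integral_smul_measure]
  change _ • ∫ ζ, f ζ ∂(Measure.map cE _) = _
  rw [integral_map cE_cont.aemeasurable hf', Real.circleAverage_def,
    intervalIntegral.integral_of_le (by positivity), integral_Ico_eq_integral_Ioc]
  congr 1
  · rw [ENNReal.toReal_inv, ENNReal.toReal_ofReal (by positivity)]
  · simp [circleMap, cE]

lemma graph_measurable (g : ℂ → ℂ) (τ : ℂ)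
    (hg : ∀ θ : ℝ, Complex.exp ((θ : ℂ) * Complex.I) ≠ τ →
      AnalyticAt ℝ (fun t : ℝ => g (Complex.exp ((t : ℂ) * Complex.I))) θ) :
    ∃ G : ℂ → ℂ, Measurable G ∧ ∀ z, ‖z‖ = 1 → z ≠ τ → G z = g z := by
  classical
  have hS : MeasurableSet (cE ⁻¹' {τ}ᶜ) := (isOpen_compl_singleton.preimage cE_cont).measurableSet
  have hc : ContinuousOn (fun t : ℝ => g (cE t)) (cE ⁻¹' {τ}ᶜ) := fun θ hθ =>
    (hg θ hθ).continuousAt.continuousWithinAt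
  have hm := hc.measurable_piecewise (continuousOn_const (c := (0:ℂ))) hS
  refine ⟨_, hm.comp Complex.measurable_arg, ?_⟩
  intro z hz hzτ
  have h1 : cE (arg z) = z := by
    have := Complex.norm_mul_exp_arg_mul_I z
    rw [hz] at this
    simpa [cE] using this
  have : arg z ∈ cE ⁻¹' {τ}ᶜ := by simpa [h1] using hzτ
  rw [Function.comp_apply, Set.piecewise_eq_of_mem _ _ _ this, h1]

/-- one-variable Poisson kernel -/
def pk (w ζ : ℂ) : ℝ := (1 - ‖w‖ ^ 2) / ‖ζ - w‖ ^ 2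

lemma pk_meas : Measurable (fun x : ℂ × ℂ => pk x.1 x.2) := by unfold pk; fun_prop

lemma pk_nonneg (w ζ : ℂ) (hw : ‖w‖ < 1) : 0 ≤ pk w ζ := by
  unfold pk
  apply div_nonneg _ (by positivity)
  nlinarith [norm_nonneg w]

lemma pk_le (w ζ : ℂ) (hw : ‖w‖ < 1) (hζ : ‖ζ‖ = 1) : pk w ζ ≤ 1 / (1 - ‖w‖) ^ 2 := by
  unfold pk
  have h1 : 1 - ‖w‖ ≤ ‖ζ - w‖ := by rw [← hζ]; exact norm_sub_norm_le _ _
  have h0 : 0 < 1 - ‖w‖ := by linarith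
  gcongr
  nlinarith [norm_nonneg w]

lemma poisson_formula (F : ℂ → ℂ) (hF : DiffContOnCl ℂ F (Metric.ball 0 1)) (hm : Measurable F)
    (w : ℂ) (hw : ‖w‖ < 1) :
    ∫ ζ, (pk w ζ : ℂ) * F ζ ∂mCircle = F w := by
  have := hF.circleAverage_poissonKernel_smul' (w := w) (by simpa using hw)
  rw [mCircle_integral]
  · rw [← this]
    apply Real.circleAverage_congr_sphere
    intro z hz
    have hz1 : ‖z‖ = 1 := by simpa using hz
    simp [pk, hz1]
  · have h2 : Measurable (fun ζ => pk w ζ) := by unfold pk; fun_prop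
    have h3 : Measurable (fun ζ => (pk w ζ : ℂ)) := Complex.measurable_ofReal.comp h2
    exact (h3.mul hm).aestronglyMeasurable

/-- the Poisson extension -/
def UU (p pt : MvPolynomial (Fin 2) ℂ) (α : ℂ) (z : ℂ × ℂ) : ℝ :=
  (‖ev p z‖ ^ 2 - ‖ev pt z‖ ^ 2) / ‖α * ev p z - ev pt z‖ ^ 2

lemma UU_eq {p pt : MvPolynomial (Fin 2) ℂ} {α : ℂ} {z : ℂ × ℂ} (hp : ev p z ≠ 0) :
    (1 - ‖rif p pt z‖ ^ 2) / ‖α - rif p pt z‖ ^ 2 = UU p pt α z := by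
  have h1 : ‖ev p z‖ ≠ 0 := by simpa using hp
  have e : α - rif p pt z = (α * ev p z - ev pt z) / ev p z := by
    rw [rif]; field_simp
  rw [e, rif, UU, norm_div, norm_div, div_pow, div_pow]
  by_cases h0 : ‖α * ev p z - ev pt z‖ = 0
  · simp [h0]
  · field_simp

lemma poisson_UU {m n : ℕ} {p pt : MvPolynomial (Fin 2) ℂ} (h : IsRIF2 m n p pt) (α : ℂ) (hα : ‖α‖ = 1)
    (g : Fin n → ℂ → ℂ) (hparam : levelSet2 p pt α = graphUnion n g) (a b : ℂ) (ha : ‖a‖ < 1)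
    (hb : ‖b‖ < 1) :
    ∫⁻ ζ, ENNReal.ofReal (pk a ζ * UU p pt α (ζ, b)) ∂mCircle = ENNReal.ofReal (UU p pt α (a, b)) := by
  set F : ℂ → ℂ := fun ζ => (α * ev p (ζ, b) + ev pt (ζ, b)) / (α * ev p (ζ, b) - ev pt (ζ, b)) with hFd
  have d1 : ∀ (q : MvPolynomial (Fin 2) ℂ), Differentiable ℂ (fun a => ev q (a, b)) := fun q =>
    (ev_differentiable q).comp (by fun_prop)
  have hFre : ∀ ζ, (F ζ).re = UU p pt α (ζ, b) := fun ζ => re_herglotz_aux α _ _ hα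
  have hcl : closure (Metric.ball (0:ℂ) 1) = Metric.closedBall 0 1 := closure_ball _ one_ne_zero
  have hdiff : DifferentiableOn ℂ F (Metric.closedBall 0 1) := by
    intro x hx
    have hx1 : ‖x‖ ≤ 1 := by simpa using hx
    have e1 := d1 p x
    have e2 := d1 pt x
    exact (((e1.const_mul α).add e2).div ((e1.const_mul α).sub e2)
      (R_ne h α hα g hparam x b hx1 hb)).differentiableWithinAt
  have hd : DiffContOnCl ℂ F (Metric.ball 0 1) := by
    apply DifferentiableOn.diffContOnCl
    rwa [hcl]
  have hm : Measurable F := by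
    have c1 : Measurable (fun a => ev p (a, b)) := (d1 p).continuous.measurable
    have c2 : Measurable (fun a => ev pt (a, b)) := (d1 pt).continuous.measurable
    exact ((c1.const_mul α).add c2).div ((c1.const_mul α).sub c2)
  have hpf := poisson_formula F hd hm a ha
  obtain ⟨M, hM⟩ := (isCompact_closedBall (0:ℂ) 1).exists_bound_of_continuousOn hdiff.continuousOn
  have h2 : Measurable (fun ζ => pk a ζ) := by unfold pk; fun_prop
  have h3 : Measurable (fun ζ => (pk a ζ : ℂ)) := Complex.measurable_ofReal.comp h2
  have hint : Integrable (fun ζ => (pk a ζ : ℂ) * F ζ) mCircle := by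
    refine Integrable.of_bound (h3.mul hm).aestronglyMeasurable (1 / (1 - ‖a‖) ^ 2 * M) ?_
    filter_upwards [mCircle_norm] with ζ hζ
    rw [norm_mul, Complex.norm_real, Real.norm_of_nonneg (pk_nonneg a ζ ha)]
    exact mul_le_mul (pk_le a ζ ha hζ) (hM ζ (by simp [hζ])) (norm_nonneg _) (by positivity)
  have hre : ∀ ζ, ((pk a ζ : ℂ) * F ζ).re = pk a ζ * UU p pt α (ζ, b) := by
    intro ζ; rw [Complex.re_ofReal_mul, hFre]
  have hI : ∫ ζ, pk a ζ * UU p pt α (ζ, b) ∂mCircle = UU p pt α (a, b) := by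
    rw [← hFre, ← hpf]
    have := integral_re hint
    simp only [RCLike.re_to_complex, hre] at this
    exact this
  have hir : Integrable (fun ζ => pk a ζ * UU p pt α (ζ, b)) mCircle := by
    have := hint.re
    simp only [RCLike.re_to_complex, hre] at this
    exact this
  rw [← hI, ofReal_integral_eq_lintegral_ofReal hir]
  filter_upwards [mCircle_norm] with ζ hζ
  refine mul_nonneg (pk_nonneg a ζ ha) (div_nonneg ?_ (by positivity))
  have := bound_closed h (ζ, b) ⟨hζ.le, hb.le⟩
  have := norm_nonneg (ev pt (ζ, b))
  simp only [sub_nonneg]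
  gcongr

/-- the candidate Clark measure -/
def muC {n : ℕ} (p pt : MvPolynomial (Fin 2) ℂ) (G : Fin n → ℂ → ℂ) : Measure (ℂ × ℂ) :=
  ∑ j, Measure.map (fun ζ => (ζ, G j ζ))
    (mCircle.withDensity (fun ζ => ENNReal.ofReal (‖dphi2 p pt (ζ, G j ζ)‖⁻¹)))

lemma dphi2_meas (p pt : MvPolynomial (Fin 2) ℂ) : Measurable (dphi2 p pt) := by
  unfold dphi2
  have := fun q => (ev_continuous q).measurable
  exact (((this _).mul (this _)).sub ((this _).mul (this _))).div ((this _).pow_const 2)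

lemma dens_meas (p pt : MvPolynomial (Fin 2) ℂ) {G : ℂ → ℂ} (hG : Measurable G) :
    Measurable (fun ζ => ‖dphi2 p pt (ζ, G ζ)‖⁻¹) :=
  ((dphi2_meas p pt).comp (measurable_id.prodMk hG)).norm.inv

lemma muC_lintegral {n : ℕ} (p pt : MvPolynomial (Fin 2) ℂ) (G : Fin n → ℂ → ℂ)
    (hG : ∀ j, Measurable (G j)) (k : ℂ × ℂ → ENNReal) (hk : Measurable k) :
    ∫⁻ z, k z ∂(muC p pt G) =
      ∑ j, ∫⁻ ζ, ENNReal.ofReal (‖dphi2 p pt (ζ, G j ζ)‖⁻¹) * k (ζ, G j ζ) ∂mCircle := by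
  unfold muC
  rw [lintegral_finsetSum_measure]
  refine Finset.sum_congr rfl fun j _ => ?_
  have hgm : Measurable (fun ζ => (ζ, G j ζ)) := measurable_id.prodMk (hG j)
  rw [lintegral_map hk hgm]
  exact lintegral_withDensity_eq_lintegral_mul _ (dens_meas p pt (hG j)).ennreal_ofReal (hk.comp hgm)

lemma poisson2_eq (z ζ : ℂ × ℂ) : poisson2 z ζ = pk z.1 ζ.1 * pk z.2 ζ.2 := rfl

lemma torus2_meas : MeasurableSet torus2 := by
  unfold torus2
  exact ((isClosed_eq (by fun_prop) continuous_const).inter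
    (isClosed_eq (by fun_prop) continuous_const)).measurableSet

lemma muC_clark {m n : ℕ} {p pt : MvPolynomial (Fin 2) ℂ} (h : IsRIF2 m n p pt) (α : ℂ) (hα : ‖α‖ = 1)
    (g : Fin n → ℂ → ℂ) (hparam : levelSet2 p pt α = graphUnion n g)
    (G : Fin n → ℂ → ℂ) (hG : ∀ j, Measurable (G j))
    (hg1 : ∀ j, ∀ ζ : ℂ, ‖ζ‖ = 1 → ‖g j ζ‖ = 1)
    (hGg : ∀ᵐ ζ ∂mCircle, ∀ j, G j ζ = g j ζ) : IsClarkMeasure2 p pt α (muC p pt G) := by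
  constructor
  · have : ∫⁻ z, Set.indicator torus2ᶜ 1 z ∂(muC p pt G) = 0 := by
      rw [muC_lintegral p pt G hG _ (measurable_one.indicator torus2_meas.compl)]
      refine Finset.sum_eq_zero fun j _ => ?_
      rw [lintegral_congr_ae (g := fun _ => 0), lintegral_zero]
      filter_upwards [hGg, mCircle_norm] with ζ h1 h2
      have : (ζ, G j ζ) ∈ torus2 := ⟨h2, by rw [h1]; exact hg1 j ζ h2⟩
      simp [this]
    rwa [lintegral_indicator_one torus2_meas.compl] at this
  · intro z hz
    rw [UU_eq (h.stable z hz), ← poisson_UU h α hα g hparam z.1 z.2 hz.1 hz.2]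
    have hk : Measurable (fun ζ : ℂ × ℂ => ENNReal.ofReal (poisson2 z ζ)) := by
      apply Measurable.ennreal_ofReal
      unfold poisson2; fun_prop
    rw [muC_lintegral p pt G hG _ hk, ← lintegral_finsetSum]
    · obtain ⟨S, hS, hf⟩ := fibre_formula h α hα g hparam
      apply lintegral_congr_ae
      filter_upwards [hGg, mCircle_norm, mCircle_finite hS] with ζ h1 h2 h3
      have hU : UU p pt α (ζ, z.2) = ∑ j, pk z.2 (g j ζ) * ‖dphi2 p pt (ζ, g j ζ)‖⁻¹ :=
        (hf ζ h2 h3).2 z.2 hz.2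
      rw [hU, Finset.mul_sum, ENNReal.ofReal_sum_of_nonneg]
      · refine Finset.sum_congr rfl fun j _ => ?_
        rw [← ENNReal.ofReal_mul (by positivity), h1, poisson2_eq]
        congr 1
        ring
      · intro j _
        exact mul_nonneg (pk_nonneg _ _ hz.1) (mul_nonneg (pk_nonneg _ _ hz.2) (by positivity))
    · intro j _
      exact (dens_meas p pt (hG j)).ennreal_ofReal.mul (hk.comp (measurable_id.prodMk (hG j)))

/-- monomials on the circle -/
def mono (k : ℤ) (z : ℂ) : ℂ := if 0 ≤ k then z ^ k.toNat else (starRingEnd ℂ) z ^ (-k).toNat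

lemma mono_cont (k : ℤ) : Continuous (mono k) := by
  unfold mono
  by_cases h : 0 ≤ k
  · simp only [h, if_true]; fun_prop
  · simp only [h, if_false]
    exact Complex.continuous_conj.pow _

lemma mono_norm (k : ℤ) (z : ℂ) (hz : ‖z‖ = 1) : ‖mono k z‖ = 1 := by
  unfold mono; split_ifs <;> simp [hz]

lemma pk_symm (η ζ : ℂ) (hη : ‖η‖ = 1) (hζ : ‖ζ‖ = 1) : pk (η / 2) ζ = pk (ζ / 2) η := by
  unfold pk
  have e : ‖ζ - η / 2‖ ^ 2 = ‖η - ζ / 2‖ ^ 2 := by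
    rw [Complex.sq_norm, Complex.sq_norm, Complex.normSq_sub, Complex.normSq_sub]
    have h1 : Complex.normSq η = 1 := by rw [Complex.normSq_eq_norm_sq, hη]; simp
    have h2 : Complex.normSq ζ = 1 := by rw [Complex.normSq_eq_norm_sq, hζ]; simp
    have h3 : (ζ * (starRingEnd ℂ) (η / 2)).re = (η * (starRingEnd ℂ) (ζ / 2)).re := by
      have : (2:ℂ)⁻¹ = ((2⁻¹ : ℝ) : ℂ) := by push_cast; rfl
      rw [div_eq_mul_inv, div_eq_mul_inv, this, map_mul, map_mul, Complex.conj_ofReal, ← mul_assoc,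
        ← mul_assoc, Complex.re_mul_ofReal, Complex.re_mul_ofReal]
      simp [Complex.mul_re]; ring
    rw [h3]
    simp [h1, h2]
  rw [e]; simp [hη, hζ]

lemma mono_poisson (k : ℤ) (ζ : ℂ) (hζ : ‖ζ‖ = 1) :
    ∫ η, mono k η * (pk (η / 2) ζ : ℂ) ∂mCircle = (1 / 2) ^ k.natAbs * mono k ζ := by
  have hz2 : ‖ζ / 2‖ < 1 := by simp [hζ]; norm_num
  have base : ∀ j : ℕ, ∫ η, (pk (ζ / 2) η : ℂ) * η ^ j ∂mCircle = (ζ / 2) ^ j := by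
    intro j
    refine poisson_formula (fun η => η ^ j) ?_ (by fun_prop) _ hz2
    exact (by fun_prop : Differentiable ℂ (fun η : ℂ => η ^ j)).diffContOnCl
  have e1 : ∫ η, mono k η * (pk (η / 2) ζ : ℂ) ∂mCircle = ∫ η, (pk (ζ / 2) η : ℂ) * mono k η ∂mCircle := by
    apply integral_congr_ae
    filter_upwards [mCircle_norm] with η hη
    rw [pk_symm η ζ hη hζ, mul_comm]
  rw [e1]
  by_cases h : 0 ≤ k
  · have : k.natAbs = k.toNat := by omega
    simp only [mono, h, if_true]
    rw [base, this]; ring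
  · have : k.natAbs = (-k).toNat := by omega
    simp only [mono, h, if_false]
    have := congrArg (starRingEnd ℂ) (base (-k).toNat)
    rw [← integral_conj] at this
    simp only [map_mul, Complex.conj_ofReal, map_pow] at this
    rw [this, ‹k.natAbs = _›]
    have hc : (starRingEnd ℂ) (2:ℂ) = 2 := map_ofNat _ 2
    rw [map_div₀, hc, div_pow, div_pow, one_pow]; ring

lemma clark_finite {p pt : MvPolynomial (Fin 2) ℂ} (α : ℂ)
    (σ : Measure (ℂ × ℂ)) (hσ : IsClarkMeasure2 p pt α σ) : IsFiniteMeasure σ := by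
  have h0 := hσ.2 (0, 0) (by simp [bidisk])
  have hae : ∀ᵐ z ∂σ, z ∈ torus2 := hσ.1
  have : ∫⁻ ζ, ENNReal.ofReal (poisson2 (0, 0) ζ) ∂σ = σ Set.univ := by
    rw [← lintegral_one]
    apply lintegral_congr_ae
    filter_upwards [hae] with z hz
    have h1 : ‖z.1‖ = 1 := hz.1
    have h2 : ‖z.2‖ = 1 := hz.2
    simp [poisson2, h1, h2]
  constructor
  rw [← this, h0]
  exact ENNReal.ofReal_lt_top

lemma clark_poisson {p pt : MvPolynomial (Fin 2) ℂ} (α : ℂ)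
    (σ : Measure (ℂ × ℂ)) (hσ : IsClarkMeasure2 p pt α σ) (z : ℂ × ℂ) (hz : z ∈ bidisk) :
    ∫ ζ, poisson2 z ζ ∂σ =
     (ENNReal.ofReal ((1 - ‖rif p pt z‖ ^ 2) / ‖α - rif p pt z‖ ^ 2)).toReal := by
  rw [integral_eq_lintegral_of_nonneg_ae, hσ.2 z hz]
  · exact Eventually.of_forall fun ζ => mul_nonneg (pk_nonneg _ _ hz.1) (pk_nonneg _ _ hz.2)
  · apply Measurable.aestronglyMeasurable
    unfold poisson2; fun_prop

lemma clark_moment {p pt : MvPolynomial (Fin 2) ℂ} (α : ℂ)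
    (σ : Measure (ℂ × ℂ)) [IsFiniteMeasure σ] (hσ : IsClarkMeasure2 p pt α σ) (a b : ℤ) :
    ((1 / 2) ^ a.natAbs * (1 / 2) ^ b.natAbs : ℂ) * ∫ z, mono a z.1 * mono b z.2 ∂σ =
    ∫ η, mono a η.1 * mono b η.2 * (((ENNReal.ofReal ((1 - ‖rif p pt (η.1 / 2, η.2 / 2)‖ ^ 2)
      / ‖α - rif p pt (η.1 / 2, η.2 / 2)‖ ^ 2)).toReal : ℝ) : ℂ) ∂(mCircle.prod mCircle) := by
  have hae : ∀ᵐ z ∂σ, z ∈ torus2 := hσ.1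
  have hM : ∀ᵐ η ∂(mCircle.prod mCircle), η ∈ torus2 := by
    have h1 : ∀ᵐ η ∂(mCircle.prod mCircle), ‖η.1‖ = 1 := Measure.quasiMeasurePreserving_fst.ae mCircle_norm
    have h2 : ∀ᵐ η ∂(mCircle.prod mCircle), ‖η.2‖ = 1 := Measure.quasiMeasurePreserving_snd.ae mCircle_norm
    filter_upwards [h1, h2] with η h1 h2 using ⟨h1, h2⟩
  have hhalf : ∀ c : ℂ, ‖c‖ = 1 → ‖c / 2‖ = 1 / 2 := by intro c hc; simp [hc]
  have hbd : ∀ η ∈ torus2, (η.1 / 2, η.2 / 2) ∈ bidisk := by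
    intro η hη
    have h1 := hhalf _ hη.1
    have h2 := hhalf _ hη.2
    constructor
    · change ‖η.1 / 2‖ < 1; rw [h1]; norm_num
    · change ‖η.2 / 2‖ < 1; rw [h2]; norm_num
  set K : ℂ × ℂ → ℂ × ℂ → ℂ := fun z η =>
    mono a η.1 * mono b η.2 * ((poisson2 (η.1 / 2, η.2 / 2) z : ℝ) : ℂ) with hK
  have hKm : Measurable (Function.uncurry K) := by
    have m1 := (mono_cont a).measurable
    have m2 := (mono_cont b).measurable
    have m3 : Measurable (fun x : (ℂ × ℂ) × (ℂ × ℂ) => poisson2 (x.2.1 / 2, x.2.2 / 2) x.1) := by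
      unfold poisson2; fun_prop
    have m4 := Complex.measurable_ofReal.comp m3
    exact ((m1.comp (measurable_fst.comp measurable_snd)).mul
      (m2.comp (measurable_snd.comp measurable_snd))).mul m4
  have hKi : Integrable (Function.uncurry K) (σ.prod (mCircle.prod mCircle)) := by
    refine Integrable.of_bound hKm.aestronglyMeasurable (4 * 4) ?_
    have h1 : ∀ᵐ x ∂(σ.prod (mCircle.prod mCircle)), x.1 ∈ torus2 := Measure.quasiMeasurePreserving_fst.ae hae
    have h2 : ∀ᵐ x ∂(σ.prod (mCircle.prod mCircle)), x.2 ∈ torus2 := Measure.quasiMeasurePreserving_snd.ae hM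
    filter_upwards [h1, h2] with x h1 h2
    have hb := hbd _ h2
    have key : ∀ c d : ℂ, ‖c‖ = 1 → ‖d‖ = 1 → pk (c / 2) d ≤ 4 := by
      intro c d hc hd
      refine (pk_le _ _ (by rw [hhalf c hc]; norm_num) hd).trans ?_
      rw [hhalf c hc]; norm_num
    simp only [Function.uncurry, hK, norm_mul, mono_norm _ _ h2.1, mono_norm _ _ h2.2, one_mul, poisson2_eq,
      Complex.norm_real]
    rw [Real.norm_of_nonneg (pk_nonneg _ _ hb.1), Real.norm_of_nonneg (pk_nonneg _ _ hb.2)]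
    exact mul_le_mul (key _ _ h2.1 h1.1) (key _ _ h2.2 h1.2) (pk_nonneg _ _ hb.2) (by norm_num)
  have hswap := integral_integral_swap hKi
  have hL : ∫ z, ∫ η, K z η ∂(mCircle.prod mCircle) ∂σ =
      ((1 / 2) ^ a.natAbs * (1 / 2) ^ b.natAbs : ℂ) * ∫ z, mono a z.1 * mono b z.2 ∂σ := by
    rw [← integral_const_mul]
    apply integral_congr_ae
    filter_upwards [hae] with z hz
    have : ∀ η : ℂ × ℂ, K z η = (mono a η.1 * (pk (η.1 / 2) z.1 : ℂ)) * (mono b η.2 * (pk (η.2 / 2) z.2 : ℂ)) := by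
      intro η; simp only [hK, poisson2_eq]; push_cast; ring
    simp only [this]
    rw [integral_prod_mul (fun x : ℂ => mono a x * (pk (x / 2) z.1 : ℂ)) (fun x : ℂ => mono b x * (pk (x / 2) z.2 : ℂ)),
      mono_poisson a z.1 hz.1, mono_poisson b z.2 hz.2]
    ring
  rw [← hL, hswap]
  apply integral_congr_ae
  filter_upwards [hM] with η hη
  simp only [hK]
  rw [integral_const_mul, integral_complex_ofReal, clark_poisson α σ hσ _ (hbd η hη)]

lemma clark_moment_eq {p pt : MvPolynomial (Fin 2) ℂ} (α : ℂ)
    (σ μ : Measure (ℂ × ℂ)) [IsFiniteMeasure σ] [IsFiniteMeasure μ] (hσ : IsClarkMeasure2 p pt α σ)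
    (hμ : IsClarkMeasure2 p pt α μ) (a b : ℤ) :
    ∫ z, mono a z.1 * mono b z.2 ∂σ = ∫ z, mono a z.1 * mono b z.2 ∂μ := by
  have h := (clark_moment α σ hσ a b).trans (clark_moment α μ hμ a b).symm
  exact mul_left_cancel₀ (by simp) h

/-- measurable inverse parametrisation of the torus -/
def sT (z : ℂ × ℂ) : UnitAddTorus (Fin 2) :=
  ![((arg z.1 / (2 * Real.pi) : ℝ) : UnitAddCircle), ((arg z.2 / (2 * Real.pi) : ℝ) : UnitAddCircle)]

/-- parametrisation of the torus -/
def eT (x : UnitAddTorus (Fin 2)) : ℂ × ℂ := (fourier 1 (x 0), fourier 1 (x 1))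

lemma sT_meas : Measurable sT := by
  unfold sT
  rw [measurable_pi_iff]
  have : Measurable (fun t : ℝ => (t : UnitAddCircle)) := (AddCircle.continuous_mk' 1).measurable
  intro i
  fin_cases i
  · exact this.comp ((Complex.measurable_arg.comp measurable_fst).div_const _)
  · exact this.comp ((Complex.measurable_arg.comp measurable_snd).div_const _)

lemma eT_cont : Continuous eT := by unfold eT; fun_prop

lemma fourier_arg (k : ℤ) (z : ℂ) (hz : ‖z‖ = 1) :
    fourier k ((arg z / (2 * Real.pi) : ℝ) : UnitAddCircle) = mono k z := by
  have h1 : Complex.exp (arg z * I) = z := by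
    have := Complex.norm_mul_exp_arg_mul_I z
    rw [hz] at this
    simpa using this
  have hpi : (Real.pi : ℂ) ≠ 0 := by exact_mod_cast Real.pi_ne_zero
  have h2 : fourier k ((arg z / (2 * Real.pi) : ℝ) : UnitAddCircle) = z ^ k := by
    rw [fourier_coe_apply, ← h1, ← Complex.exp_int_mul, h1]
    congr 1
    push_cast
    field_simp
  rw [h2]
  unfold mono
  split_ifs with h
  · obtain ⟨j, rfl⟩ := Int.eq_ofNat_of_zero_le h
    simp
  · obtain ⟨j, hj⟩ := Int.eq_ofNat_of_zero_le (by omega : 0 ≤ -k)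
    have hk : k = -(j : ℤ) := by omega
    subst hk
    have : (starRingEnd ℂ) z = z⁻¹ := by
      rw [Complex.inv_def, Complex.normSq_eq_norm_sq, hz]; simp
    simp [this]

lemma eT_sT (z : ℂ × ℂ) (hz : z ∈ torus2) : eT (sT z) = z := by
  have e : ∀ c, mono 1 c = c := by intro c; simp [mono]
  refine Prod.ext ?_ ?_
  · exact (fourier_arg 1 z.1 hz.1).trans (e _)
  · exact (fourier_arg 1 z.2 hz.2).trans (e _)

lemma torus_ext (P Q : Measure (UnitAddTorus (Fin 2))) [IsFiniteMeasure P] [IsFiniteMeasure Q]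
    (h : ∀ k : Fin 2 → ℤ, ∫ x, UnitAddTorus.mFourier k x ∂P = ∫ x, UnitAddTorus.mFourier k x ∂Q) : P = Q := by
  have hint : ∀ (ν : Measure (UnitAddTorus (Fin 2))) [IsFiniteMeasure ν] (f : C(UnitAddTorus (Fin 2), ℂ)),
      Integrable f ν := fun ν _ f => f.continuous.integrable_of_hasCompactSupport
        (HasCompactSupport.of_compactSpace _)
  let V : Submodule ℂ C(UnitAddTorus (Fin 2), ℂ) :=
    { carrier := {f | ∫ x, f x ∂P = ∫ x, f x ∂Q}
      zero_mem' := by simp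
      add_mem' := by
        intro f g hf hg
        change ∫ x, f x + g x ∂P = ∫ x, f x + g x ∂Q
        rw [integral_add (hint P f) (hint P g), integral_add (hint Q f) (hint Q g)]
        exact congrArg₂ _ hf hg
      smul_mem' := by
        intro c f hf
        change ∫ x, c • f x ∂P = ∫ x, c • f x ∂Q
        rw [integral_smul, integral_smul]
        exact congrArg _ hf }
  have hcont : ∀ (ν : Measure (UnitAddTorus (Fin 2))) [IsFiniteMeasure ν],
      Continuous (fun f : C(UnitAddTorus (Fin 2), ℂ) => ∫ x, f x ∂ν) := by
    intro ν _
    have : LipschitzWith (ν.real Set.univ).toNNReal (fun f : C(UnitAddTorus (Fin 2), ℂ) => ∫ x, f x ∂ν) := by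
      apply LipschitzWith.of_dist_le_mul
      intro f g
      rw [dist_eq_norm, ← integral_sub (hint ν f) (hint ν g), Real.coe_toNNReal _ measureReal_nonneg, mul_comm]
      apply norm_integral_le_of_norm_le_const
      refine Eventually.of_forall fun x => ?_
      rw [← dist_eq_norm]
      exact ContinuousMap.dist_apply_le_dist x
    exact this.continuous
  have hclosed : IsClosed (V : Set C(UnitAddTorus (Fin 2), ℂ)) := isClosed_eq (hcont P) (hcont Q)
  have htop : ∀ f : C(UnitAddTorus (Fin 2), ℂ), f ∈ V := by
    intro f
    have hle : Submodule.span ℂ (Set.range (UnitAddTorus.mFourier (d := Fin 2))) ≤ V := by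
      rw [Submodule.span_le]
      rintro _ ⟨k, rfl⟩
      exact h k
    have := Submodule.topologicalClosure_minimal _ hle hclosed
    rw [UnitAddTorus.span_mFourier_closure_eq_top] at this
    exact this trivial
  apply ext_of_forall_integral_eq_of_IsFiniteMeasure
  intro f
  have := htop ⟨fun x => (f x : ℂ), by fun_prop⟩
  change ∫ x, (f x : ℂ) ∂P = ∫ x, (f x : ℂ) ∂Q at this
  rw [integral_complex_ofReal, integral_complex_ofReal] at this
  exact_mod_cast this

lemma clark_unique {p pt : MvPolynomial (Fin 2) ℂ} (α : ℂ)
    (σ μ : Measure (ℂ × ℂ)) [IsFiniteMeasure σ] [IsFiniteMeasure μ] (hσ : IsClarkMeasure2 p pt α σ)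
    (hμ : IsClarkMeasure2 p pt α μ) : σ = μ := by
  have hback : ∀ (ν : Measure (ℂ × ℂ)), IsClarkMeasure2 p pt α ν → Measure.map eT (Measure.map sT ν) = ν := by
    intro ν hν
    have hae : ∀ᵐ z ∂ν, z ∈ torus2 := hν.1
    rw [Measure.map_map eT_cont.measurable sT_meas]
    conv_rhs => rw [← Measure.map_id (μ := ν)]
    apply Measure.map_congr
    filter_upwards [hae] with z hz using eT_sT z hz
  have hmom : ∀ (ν : Measure (ℂ × ℂ)), IsClarkMeasure2 p pt α ν → ∀ k : Fin 2 → ℤ,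
      ∫ x, UnitAddTorus.mFourier k x ∂(Measure.map sT ν) = ∫ z, mono (k 0) z.1 * mono (k 1) z.2 ∂ν := by
    intro ν hν k
    have hae : ∀ᵐ z ∂ν, z ∈ torus2 := hν.1
    rw [integral_map sT_meas.aemeasurable (UnitAddTorus.mFourier k).continuous.aestronglyMeasurable]
    apply integral_congr_ae
    filter_upwards [hae] with z hz
    rw [← fourier_arg _ _ hz.1, ← fourier_arg _ _ hz.2]
    simp [UnitAddTorus.mFourier, Fin.prod_univ_two, sT]
  have : Measure.map sT σ = Measure.map sT μ := by
    apply torus_ext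
    intro k
    rw [hmom σ hσ, hmom μ hμ]
    exact clark_moment_eq α σ μ hσ hμ _ _
  rw [← hback σ hσ, ← hback μ hμ, this]

/-- Let `φ = p̃/p` be a bidegree `(m,n)` RIF on `𝔻²` and let `α ∈ 𝕋` be
a generic value for `φ`, with parameterizing functions `g₁^α, …, g_n^α` for `C_α(φ)`
(no vertical lines occur). Then for every continuous `f` on `𝕋²`,
`∫ f dσ_α = ∑_j ∫ f(ζ, g_j(ζ)) |∂φ/∂z₂(ζ, g_j(ζ))|⁻¹ dm(ζ)`. -/
theorem clark_formula_generic
    (m n : ℕ) (p pt : MvPolynomial (Fin 2) ℂ) (hRIF : IsRIF2 m n p pt)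
    (α : ℂ) (hα : ‖α‖ = 1) (hgen : IsGenericValue p pt α)
    (g : Fin n → ℂ → ℂ) (hg : IsGraphFamily n g)
    (hparam : levelSet2 p pt α = graphUnion n g)
    (σ : Measure (ℂ × ℂ)) (hσ : IsClarkMeasure2 p pt α σ) :
    ∀ f : ℂ × ℂ → ℂ, Continuous f →
      ∫ ζ, f ζ ∂σ =
        ∑ j, ∫ ζ, f (ζ, g j ζ) / (‖dphi2 p pt (ζ, g j ζ)‖ : ℂ) ∂mCircle := by
  intro f hf
  obtain ⟨hg1, τ, hτ, hga⟩ := hg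
  have hex := fun j => graph_measurable (g j) τ (hga j)
  choose G hG hGeq using hex
  have hGg : ∀ᵐ ζ ∂mCircle, ∀ j, G j ζ = g j ζ := by
    filter_upwards [mCircle_norm, mCircle_finite (Set.finite_singleton τ)] with ζ h1 h2 j
    exact hGeq j ζ h1 h2
  have hμ := muC_clark hRIF α hα g hparam G hG hg1 hGg
  haveI := clark_finite α σ hσ
  haveI := clark_finite α _ hμ
  have hEq := clark_unique α σ _ hσ hμ
  have hint : Integrable f (muC p pt G) := by
    have hK : IsCompact torus2 := by
      have : torus2 = Metric.sphere (0:ℂ) 1 ×ˢ Metric.sphere (0:ℂ) 1 := by ext z; simp [torus2]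
      rw [this]
      exact (isCompact_sphere _ _).prod (isCompact_sphere _ _)
    obtain ⟨M, hM⟩ := hK.exists_bound_of_continuousOn hf.continuousOn
    refine Integrable.of_bound hf.aestronglyMeasurable M ?_
    have hae : ∀ᵐ z ∂(muC p pt G), z ∈ torus2 := hμ.1
    filter_upwards [hae] with z hz using hM z hz
  rw [hEq]
  unfold muC at hint ⊢
  rw [integral_finsetSum_measure (fun j _ => hint.mono_measure
    (Finset.single_le_sum (f := fun j => Measure.map (fun ζ => (ζ, G j ζ))
      (mCircle.withDensity (fun ζ => ENNReal.ofReal (‖dphi2 p pt (ζ, G j ζ)‖⁻¹))))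
      (fun _ _ => Measure.zero_le _) (Finset.mem_univ j)))]
  refine Finset.sum_congr rfl fun j _ => ?_
  have hgm : Measurable (fun ζ => (ζ, G j ζ)) := measurable_id.prodMk (hG j)
  rw [integral_map hgm.aemeasurable hf.aestronglyMeasurable,
    integral_withDensity_eq_integral_toReal_smul₀ (dens_meas p pt (hG j)).ennreal_ofReal.aemeasurable
      (Eventually.of_forall fun _ => ENNReal.ofReal_lt_top)]
  apply integral_congr_ae
  filter_upwards [hGg] with ζ h1
  rw [h1, ENNReal.toReal_ofReal (by positivity), Complex.real_smul]
  push_cast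
  rw [div_eq_mul_inv, mul_comm]
end
end

section
/- Let φ = p̃/p be a bidegree (m,n) rational inner function on 𝔻² and suppose α ∈ 𝕋 is a generic value for φ. Then there exist rational functions R₁ and R₂, each holomorphic on 𝔻² and continuous on the closed bidisk (i.e. belonging to the bidisk algebra A(𝔻²)), such that conj(ζ₁) = R₁(ζ₁,ζ₂) and conj(ζ₂) = R₂(ζ₁,ζ₂) for all (ζ₁,ζ₂) ∈ C_α(φ). -/
open MeasureTheory Complex Filter Topology

noncomputable section

lemma quot_diff {A B : ℂ × ℂ → ℂ} {S : Set (ℂ × ℂ)} (hA : Differentiable ℂ A)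
    (hB : Differentiable ℂ B) (h : ∀ z ∈ S, B z ≠ 0) :
    DifferentiableOn ℂ (fun z => A z / B z) S := by
  simp only [div_eq_mul_inv]
  exact hA.differentiableOn.mul (hB.differentiableOn.fun_inv h)

lemma slice_diff {A : ℂ × ℂ → ℂ} (hA : Differentiable ℂ A) (w : ℂ) :
    Differentiable ℂ (fun x => A (x, w)) :=
  hA.comp (differentiable_id.prodMk (differentiable_const w))

lemma slice_diff' {A : ℂ × ℂ → ℂ} (hA : Differentiable ℂ A) (w : ℂ) :
    Differentiable ℂ (fun x => A (w, x)) :=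
  hA.comp ((differentiable_const w).prodMk differentiable_id)

lemma max_disc {A B : ℂ → ℂ} (hA : Differentiable ℂ A) (hB : Differentiable ℂ B)
    (hB0 : ∀ z, ‖z‖ ≤ 1 → B z ≠ 0) (h : ∀ z, ‖z‖ = 1 → ‖A z‖ ≤ ‖B z‖)
    (z : ℂ) (hz : ‖z‖ ≤ 1) : ‖A z‖ ≤ ‖B z‖ := by
  have hcl : closure (Metric.ball (0:ℂ) 1) = Metric.closedBall 0 1 :=
    closure_ball _ one_ne_zero
  have hd : DiffContOnCl ℂ (fun z => A z / B z) (Metric.ball 0 1) := by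
    apply DifferentiableOn.diffContOnCl
    rw [hcl]
    exact hA.differentiableOn.div hB.differentiableOn
      (fun x hx => hB0 x (by simpa using hx))
  have := Complex.norm_le_of_forall_mem_frontier_norm_le (C := 1) Metric.isBounded_ball hd
    (by
      intro x hx
      rw [frontier_ball _ one_ne_zero] at hx
      have hx : ‖x‖ = 1 := by simpa using hx
      rw [norm_div]
      exact div_le_one_of_le₀ (h x hx) (norm_nonneg _)) (z := z) (by rw [hcl]; simpa using hz)
  rw [norm_div, div_le_one (norm_pos_iff.2 (hB0 z hz))] at this
  exact this

lemma max_two {A B : ℂ × ℂ → ℂ} (hA : Differentiable ℂ A) (hB : Differentiable ℂ B)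
    (hB0 : ∀ z ∈ closedBidisk, B z ≠ 0) (h : ∀ z ∈ torus2, ‖A z‖ ≤ ‖B z‖)
    (z : ℂ × ℂ) (hz : z ∈ closedBidisk) : ‖A z‖ ≤ ‖B z‖ := by
  have h1 : ∀ w, ‖w‖ = 1 → ∀ x, ‖x‖ ≤ 1 → ‖A (x, w)‖ ≤ ‖B (x, w)‖ := fun w hw =>
    max_disc (slice_diff hA w) (slice_diff hB w) (fun x hx => hB0 _ ⟨hx, hw.le⟩)
      (fun x hx => h _ ⟨hx, hw⟩)
  exact max_disc (slice_diff' hA z.1) (slice_diff' hB z.1) (fun x hx => hB0 _ ⟨hz.1, hx⟩)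
      (fun x hx => h1 x hx _ hz.1) z.2 hz.2

lemma conj_inv_unit {z : ℂ} (hz : ‖z‖ = 1) (r : ℝ) :
    ((starRingEnd ℂ) (z / r))⁻¹ = r * z := by
  have h : (starRingEnd ℂ) z = z⁻¹ := (Complex.inv_eq_conj hz).symm
  rw [map_div₀, h, Complex.conj_ofReal]
  simp [div_eq_mul_inv]

lemma pt_le_p {m n : ℕ} {p pt : MvPolynomial (Fin 2) ℂ} (hR : IsRIF2 m n p pt)
    (z : ℂ × ℂ) (hz : z ∈ closedBidisk) : ‖ev pt z‖ ≤ ‖ev p z‖ := by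
  have key : ∀ r : ℝ, 0 < r → r < 1 →
      ‖(r:ℂ) ^ (m + n) * ev pt (z.1 / r, z.2 / r)‖ ≤ ‖ev p (r * z.1, r * z.2)‖ := by
    intro r h0 h1
    have hr : (r:ℂ) ≠ 0 := by exact_mod_cast h0.ne'
    refine max_two (A := fun z => (r:ℂ) ^ (m + n) * ev pt (z.1 / r, z.2 / r))
      (B := fun z => ev p (r * z.1, r * z.2)) ?_ ?_ ?_ ?_ z hz
    · exact ((ev_differentiable pt).comp (by
        simp only [div_eq_mul_inv]
        exact (differentiable_fst.mul_const _).prodMk (differentiable_snd.mul_const _))).const_mul _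
    · exact (ev_differentiable p).comp ((differentiable_fst.const_mul _).prodMk
        (differentiable_snd.const_mul _))
    · intro x hx
      apply hR.stable
      constructor
      · simp only [norm_mul, Complex.norm_real, Real.norm_eq_abs, abs_of_pos h0]
        nlinarith [hx.1, norm_nonneg x.1]
      · simp only [norm_mul, Complex.norm_real, Real.norm_eq_abs, abs_of_pos h0]
        nlinarith [hx.2, norm_nonneg x.2]
    · intro x hx
      have n1 : x.1 ≠ 0 := norm_ne_zero_iff.1 (by rw [hx.1]; exact one_ne_zero)
      have n2 : x.2 ≠ 0 := norm_ne_zero_iff.1 (by rw [hx.2]; exact one_ne_zero)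
      have := hR.reflection (x.1 / r, x.2 / r) (div_ne_zero n1 hr) (div_ne_zero n2 hr)
      simp only [conj_inv_unit hx.1, conj_inv_unit hx.2] at this
      rw [this]
      simp only [norm_mul, norm_pow, norm_div, hx.1, hx.2, Complex.norm_real, Real.norm_eq_abs,
        abs_of_pos h0, RCLike.norm_conj]
      apply le_of_eq
      have hr' := h0.ne'
      rw [pow_add, one_div, inv_pow, inv_pow]
      field_simp
  have c : Tendsto (fun r : ℝ => (r:ℂ)) (𝓝[<] (1:ℝ)) (𝓝 1) := by
    have : Tendsto (fun r : ℝ => (r:ℂ)) (𝓝 (1:ℝ)) (𝓝 ((1:ℝ):ℂ)) :=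
      Complex.continuous_ofReal.tendsto 1
    simpa using this.mono_left nhdsWithin_le_nhds
  have t1 : Tendsto (fun r : ℝ => ‖(r:ℂ) ^ (m + n) * ev pt (z.1 / r, z.2 / r)‖) (𝓝[<] (1:ℝ))
      (𝓝 ‖(1:ℂ) ^ (m + n) * ev pt (z.1 / 1, z.2 / 1)‖) := by
    refine ((c.pow _).mul (((ev_continuous pt).tendsto _).comp ?_)).norm
    exact (tendsto_const_nhds.div c one_ne_zero).prodMk_nhds
      (tendsto_const_nhds.div c one_ne_zero)
  have t2 : Tendsto (fun r : ℝ => ‖ev p (r * z.1, r * z.2)‖) (𝓝[<] (1:ℝ))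
      (𝓝 ‖ev p (1 * z.1, 1 * z.2)‖) := by
    refine (((ev_continuous p).tendsto _).comp ?_).norm
    exact (c.mul_const _).prodMk_nhds (c.mul_const _)
  have := le_of_tendsto_of_tendsto t1 t2 (by
    filter_upwards [Ioo_mem_nhdsLT (zero_lt_one' ℝ)] with r hr
    exact key r hr.1 hr.2)
  simpa using this

lemma dvd_sub_slice (τ : ℂ) (Q : MvPolynomial (Fin 2) ℂ) :
    (MvPolynomial.X 1 - MvPolynomial.C τ) ∣
      Q - MvPolynomial.aeval ![MvPolynomial.X 0, MvPolynomial.C τ] Q := by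
  induction Q using MvPolynomial.induction_on with
  | C a => simp
  | add p q hp hq =>
    rw [map_add, add_sub_add_comm]; exact dvd_add hp hq
  | mul_X p i hp =>
    obtain ⟨g, hg⟩ := hp
    rw [map_mul, MvPolynomial.aeval_X]
    rw [sub_eq_iff_eq_add] at hg
    fin_cases i
    · refine ⟨g * MvPolynomial.X 0, ?_⟩
      simp only [Fin.zero_eta, Matrix.cons_val_zero]
      linear_combination (MvPolynomial.X 0) * hg
    · refine ⟨p + g * MvPolynomial.C τ, ?_⟩
      simp only [Fin.mk_one, Matrix.cons_val_one, Matrix.cons_val_zero]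
      linear_combination (MvPolynomial.C τ) * hg

lemma dvd_sub_slice0 (Q : MvPolynomial (Fin 2) ℂ) :
    (MvPolynomial.X 0) ∣ Q - MvPolynomial.aeval ![0, MvPolynomial.X 1] Q := by
  induction Q using MvPolynomial.induction_on with
  | C a => simp
  | add p q hp hq =>
    rw [map_add, add_sub_add_comm]; exact dvd_add hp hq
  | mul_X p i hp =>
    obtain ⟨g, hg⟩ := hp
    rw [map_mul, MvPolynomial.aeval_X]
    rw [sub_eq_iff_eq_add] at hg
    fin_cases i
    · refine ⟨p, ?_⟩
      simp only [Fin.zero_eta, Matrix.cons_val_zero]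
      ring
    · refine ⟨g * MvPolynomial.X 1, ?_⟩
      simp only [Fin.mk_one, Matrix.cons_val_one, Matrix.cons_val_zero]
      linear_combination (MvPolynomial.X 1) * hg

lemma ev_aeval (Q f g : MvPolynomial (Fin 2) ℂ) (z : ℂ × ℂ) :
    ev (MvPolynomial.aeval ![f, g] Q) z = ev Q (ev f z, ev g z) := by
  unfold ev
  induction Q using MvPolynomial.induction_on with
  | C a => simp
  | add p q hp hq => simp only [map_add, hp, hq]
  | mul_X p i hp =>
    simp only [map_mul, hp, MvPolynomial.aeval_X, MvPolynomial.eval_X]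
    fin_cases i <;> simp

/-- A function with `A(·,τ)=0` near a point of the disc vanishes on the slice. -/
lemma slice_zero_of_eventually (p : MvPolynomial (Fin 2) ℂ) (τ a : ℂ)
    (h : ∀ᶠ x in 𝓝 a, ev p (x, τ) = 0) (x : ℂ) : ev p (x, τ) = 0 := by
  have han : AnalyticOnNhd ℂ (fun x => ev p (x, τ)) Set.univ :=
    fun x _ => (slice_diff (ev_differentiable p) τ).analyticAt x
  exact han.eqOn_zero_of_preconnected_of_eventuallyEq_zero isPreconnected_univ
    (Set.mem_univ a) h (Set.mem_univ x)

lemma slice_dvd (p : MvPolynomial (Fin 2) ℂ) (τ : ℂ) (h : ∀ x, ev p (x, τ) = 0) :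
    (MvPolynomial.X 1 - MvPolynomial.C τ) ∣ p := by
  have h0 : MvPolynomial.aeval ![(MvPolynomial.X 0 : MvPolynomial (Fin 2) ℂ),
      MvPolynomial.C τ] p = 0 := by
    apply MvPolynomial.funext
    intro x
    have := ev_aeval p (MvPolynomial.X 0) (MvPolynomial.C τ) (x 0, x 1)
    have h2 : ![x 0, x 1] = x := by ext i; fin_cases i <;> rfl
    rw [show ev (MvPolynomial.C τ) (x 0, x 1) = τ by simp [ev], h] at this
    unfold ev at this
    simp only [h2] at this
    rw [this, map_zero]
  have := dvd_sub_slice τ p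
  rwa [h0, sub_zero] at this

lemma slice_not_zero {m n : ℕ} {p pt : MvPolynomial (Fin 2) ℂ} (hR : IsRIF2 m n p pt)
    (τ : ℂ) (hτ : ‖τ‖ ≤ 1) (h : ∀ x, ev p (x, τ) = 0) : False := by
  have h2 : ∀ x, ev pt (x, τ) = 0 := by
    apply slice_zero_of_eventually pt τ 0
    filter_upwards [Metric.ball_mem_nhds (0:ℂ) one_pos] with x hx
    have hx : ‖x‖ < 1 := by simpa using hx
    have := pt_le_p hR (x, τ) ⟨hx.le, hτ⟩
    rw [h, norm_zero] at this
    exact norm_le_zero_iff.1 this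
  have hu := hR.coprime _ (slice_dvd p τ h) (slice_dvd pt τ h2)
  have := hu.map (MvPolynomial.eval ![0, τ])
  simp at this

lemma slice_ev_ne {m n : ℕ} {p pt : MvPolynomial (Fin 2) ℂ} (hR : IsRIF2 m n p pt)
    (τ : ℂ) (hτ : ‖τ‖ ≤ 1) (a : ℂ) : ∀ᶠ x in 𝓝[≠] a, ev p (x, τ) ≠ 0 := by
  rcases ((slice_diff (ev_differentiable p) τ).analyticAt a).eventually_eq_zero_or_eventually_ne_zero
    with h | h
  · exact (slice_not_zero hR τ hτ (slice_zero_of_eventually p τ a h)).elim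
  · exact h

/-- Hurwitz. -/
lemma slice_ne {m n : ℕ} {p pt : MvPolynomial (Fin 2) ℂ} (hR : IsRIF2 m n p pt)
    (τ : ℂ) (hτ : ‖τ‖ ≤ 1) (a : ℂ) (ha : ‖a‖ < 1) : ev p (a, τ) ≠ 0 := by
  intro h0
  have h1 : ∀ᶠ x in 𝓝[≠] a, ev p (x, τ) ≠ 0 ∧ x ∈ Metric.ball (0:ℂ) 1 :=
    (slice_ev_ne hR τ hτ a).and (mem_nhdsWithin_of_mem_nhds
      (Metric.isOpen_ball.mem_nhds (by simpa using ha)))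
  rw [eventually_nhdsWithin_iff, Metric.eventually_nhds_iff] at h1
  obtain ⟨e, he, h1⟩ := h1
  have hS : IsCompact (Metric.sphere a (e/2)) := isCompact_sphere _ _
  have hSne : (Metric.sphere a (e/2)).Nonempty := (NormedSpace.sphere_nonempty).2 (by positivity)
  have hin : ∀ x ∈ Metric.closedBall a (e/2), ‖x‖ < 1 := by
    intro x hx
    by_cases hxa : x = a
    · rwa [hxa]
    · have := (h1 (y := x) (lt_of_le_of_lt (Metric.mem_closedBall.1 hx) (by linarith)) hxa).2
      simpa using this
  obtain ⟨x0, hx0, hmin⟩ := hS.exists_isMinOn hSne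
    ((slice_diff (ev_differentiable p) τ).continuous.norm.continuousOn)
  have hd : 0 < ‖ev p (x0, τ)‖ := by
    apply norm_pos_iff.2
    apply (h1 _ _).1
    · rw [Metric.mem_sphere.1 hx0]; linarith
    · intro hh
      simp only [Set.mem_singleton_iff] at hh
      rw [hh] at hx0; simp at hx0; linarith
  set d := ‖ev p (x0, τ)‖ with hdd
  have hc : Continuous (fun y : ℝ × ℂ => ‖ev p (y.2, y.1 * τ)‖) :=
    ((ev_continuous p).comp (continuous_snd.prodMk
      ((Complex.continuous_ofReal.comp continuous_fst).mul continuous_const))).norm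
  have hev : ∀ᶠ r : ℝ in 𝓝 (1:ℝ), ∀ x ∈ Metric.sphere a (e/2), d / 2 < ‖ev p (x, r * τ)‖ := by
    apply hS.eventually_forall_of_forall_eventually
    intro x hx
    have h5 : d ≤ ‖ev p (x, τ)‖ := hmin hx
    have h6 := (hc.tendsto ((1:ℝ), x)).eventually_const_lt (u := d / 2)
      (by simp only [Complex.ofReal_one, one_mul]; linarith)
    exact h6
  have hev2 : ∀ᶠ r : ℝ in 𝓝 (1:ℝ), ‖ev p (a, r * τ)‖ < d / 2 := by
    have hc2 : Continuous (fun r : ℝ => ‖ev p (a, r * τ)‖) :=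
      hc.comp (g := fun y : ℝ × ℂ => ‖ev p (y.2, y.1 * τ)‖) (f := fun r : ℝ => (r, a))
        (continuous_id.prodMk continuous_const)
    exact (hc2.tendsto (1:ℝ)).eventually_lt_const (u := d / 2)
      (by simp only [Complex.ofReal_one, one_mul, h0, norm_zero]; linarith)
  have hev3 : ∀ᶠ r in 𝓝[<] (1:ℝ), r ∈ Set.Ioo (0:ℝ) 1 := Ioo_mem_nhdsLT (zero_lt_one' ℝ)
  obtain ⟨r, ⟨hr1, hr2⟩, hr3⟩ :=
    (((hev.and hev2).filter_mono nhdsWithin_le_nhds).and hev3).exists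
  have hrt : ‖(r:ℂ) * τ‖ < 1 := by
    rw [norm_mul, Complex.norm_real, Real.norm_eq_abs, abs_of_pos hr3.1]
    nlinarith [hr3.1, hr3.2, norm_nonneg τ]
  have hcl : closure (Metric.ball a (e/2)) = Metric.closedBall a (e/2) :=
    closure_ball _ (by positivity)
  have hdc : DiffContOnCl ℂ (fun x => (ev p (x, r * τ))⁻¹) (Metric.ball a (e/2)) := by
    apply DifferentiableOn.diffContOnCl
    rw [hcl]
    exact (slice_diff (ev_differentiable p) _).differentiableOn.fun_inv
      (fun x hx => hR.stable _ ⟨hin x hx, hrt⟩)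
  have := Complex.norm_le_of_forall_mem_frontier_norm_le (C := (d/2)⁻¹) Metric.isBounded_ball hdc
    (by
      intro x hx
      rw [frontier_ball _ (by positivity)] at hx
      rw [norm_inv]
      exact inv_anti₀ (by positivity) (hr1 x hx).le) (z := a)
      (by rw [hcl]; exact Metric.mem_closedBall_self (by positivity))
  rw [norm_inv, inv_le_inv₀ (norm_pos_iff.2 (hR.stable _ ⟨ha, hrt⟩)) (by positivity)] at this
  linarith

lemma mem_level {p pt : MvPolynomial (Fin 2) ℂ} {α : ℂ} {ζ : ℂ × ℂ} (h1 : ζ ∈ torus2)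
    (h2 : ev p ζ ≠ 0) (h3 : ev pt ζ = α * ev p ζ) : ζ ∈ levelSet2 p pt α := by
  apply subset_closure
  refine ⟨h1, ?_⟩
  have e : α = rif p pt ζ := by rw [rif, h3]; field_simp
  have hc : ContinuousAt (rif p pt) ζ :=
    (ev_continuous pt).continuousAt.div (ev_continuous p).continuousAt h2
  have ht : Tendsto (fun r : ℝ => ((r : ℂ) * ζ.1, (r : ℂ) * ζ.2)) (𝓝 1) (𝓝 ζ) := by
    have hh : Continuous (fun r : ℝ => ((r : ℂ) * ζ.1, (r : ℂ) * ζ.2)) := by fun_prop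
    simpa using hh.tendsto 1
  rw [e]
  exact (hc.tendsto.comp ht).mono_left nhdsWithin_le_nhds

lemma level_sub {m n : ℕ} {p pt : MvPolynomial (Fin 2) ℂ} (hR : IsRIF2 m n p pt) {α : ℂ}
    {ζ : ℂ × ℂ} (h : ζ ∈ levelSet2 p pt α) : ζ ∈ torus2 ∧ ev pt ζ = α * ev p ζ := by
  have hcl : IsClosed {ζ : ℂ × ℂ | ζ ∈ torus2 ∧ ev pt ζ = α * ev p ζ} := by
    have : IsClosed torus2 := (isClosed_eq (by fun_prop) continuous_const).inter
      (isClosed_eq (by fun_prop) continuous_const)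
    exact this.inter (isClosed_eq (ev_continuous pt) (continuous_const.mul (ev_continuous p)))
  refine closure_minimal ?_ hcl h
  rintro ζ ⟨h1, h2⟩
  refine ⟨h1, ?_⟩
  have ht : Tendsto (fun r : ℝ => ((r : ℂ) * ζ.1, (r : ℂ) * ζ.2)) (𝓝[<] 1) (𝓝 ζ) := by
    have hh : Continuous (fun r : ℝ => ((r : ℂ) * ζ.1, (r : ℂ) * ζ.2)) := by fun_prop
    have := hh.tendsto 1
    simp only [Complex.ofReal_one, one_mul] at this
    exact this.mono_left nhdsWithin_le_nhds
  have t1 := ((ev_continuous pt).tendsto ζ).comp ht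
  have t2 := h2.mul (((ev_continuous p).tendsto ζ).comp ht)
  refine tendsto_nhds_unique (t1.congr' ?_) t2
  filter_upwards [(Ioo_mem_nhdsLT (zero_lt_one' ℝ) : Set.Ioo (0:ℝ) 1 ∈ 𝓝[<] (1:ℝ))] with r hr
  have : ev p ((r : ℂ) * ζ.1, (r : ℂ) * ζ.2) ≠ 0 := by
    apply hR.stable
    constructor
    · simp only [norm_mul, Complex.norm_real, Real.norm_eq_abs, abs_of_pos hr.1, h1.1]
      linarith [hr.2]
    · simp only [norm_mul, Complex.norm_real, Real.norm_eq_abs, abs_of_pos hr.1, h1.2]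
      linarith [hr.2]
  simp only [Function.comp, rif]
  field_simp

lemma const_ne {m n : ℕ} {p pt : MvPolynomial (Fin 2) ℂ} (hR : IsRIF2 m n p pt) {α : ℂ}
    (hα : ‖α‖ = 1) (hgen : IsGenericValue p pt α) (w : ℂ) (hw : ‖w‖ ≤ 1) :
    ev pt (0, w) ≠ α * ev p (0, w) := by
  intro h
  rcases hw.lt_or_eq with hw1 | hw1
  · -- interior
    have hb : bidisk = Metric.ball (0 : ℂ × ℂ) 1 := by
      ext z; simp [bidisk, Prod.norm_def]
    have hd : DifferentiableOn ℂ (rif p pt) bidisk :=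
      quot_diff (ev_differentiable pt) (ev_differentiable p) hR.stable
    have h0 : ((0:ℂ), w) ∈ bidisk := ⟨by simp, hw1⟩
    have hv : rif p pt (0, w) = α := by
      rw [rif, h, mul_div_assoc, div_self (hR.stable _ h0), mul_one]
    have hEq := Complex.eqOn_of_isPreconnected_of_isMaxOn_norm (U := bidisk) (c := (0, w))
      (by rw [hb]; exact (convex_ball _ _).isPreconnected) (by rw [hb]; exact Metric.isOpen_ball)
      hd h0 (by
        intro z hz
        simp only [Function.comp, Set.mem_ofPred_eq, hv, hα]
        rw [rif, norm_div]
        exact div_le_one_of_le₀ (pt_le_p hR z ⟨hz.1.le, hz.2.le⟩) (norm_nonneg _))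
    have hpoly : pt = MvPolynomial.C α * p := by
      apply MvPolynomial.funext_set (fun _ => Metric.ball (0:ℂ) 1)
      · intro i
        exact infinite_of_mem_nhds (0:ℂ) (Metric.ball_mem_nhds _ one_pos)
      · intro x hx
        have h2 : ![x 0, x 1] = x := by ext i; fin_cases i <;> rfl
        have hxb : (x 0, x 1) ∈ bidisk :=
          ⟨by simpa using hx 0 (Set.mem_univ _), by simpa using hx 1 (Set.mem_univ _)⟩
        have := hEq hxb
        simp only [Function.const, hv] at this
        rw [rif, div_eq_iff (hR.stable _ hxb)] at this
        simp only [ev, h2] at this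
        simpa using this
    have hu := hR.coprime p dvd_rfl (hpoly ▸ dvd_mul_left _ _)
    rw [MvPolynomial.isUnit_iff_eq_C_of_isReduced] at hu
    obtain ⟨c, -, hc⟩ := hu
    have := hR.deg1
    rw [hc, MvPolynomial.degreeOf_C] at this
    have := hR.hm
    omega
  · have hne := slice_ne hR w hw
    have hd : DifferentiableOn ℂ (fun x => rif p pt (x, w)) (Metric.ball 0 1) :=
      (slice_diff (ev_differentiable pt) w).differentiableOn.div
        (slice_diff (ev_differentiable p) w).differentiableOn (fun x hx => hne x (by simpa using hx))
    have hv : rif p pt (0, w) = α := by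
      rw [rif, h, mul_div_assoc, div_self (hne 0 (by simp)), mul_one]
    have hEq := Complex.eqOn_of_isPreconnected_of_isMaxOn_norm (U := Metric.ball (0:ℂ) 1) (c := 0)
      (convex_ball _ _).isPreconnected Metric.isOpen_ball
      hd (by simp) (by
        intro z hz
        have hz : ‖z‖ < 1 := by simpa using hz
        simp only [Function.comp, Set.mem_ofPred_eq, hv, hα]
        rw [rif, norm_div]
        exact div_le_one_of_le₀ (pt_le_p hR _ ⟨hz.le, hw⟩) (norm_nonneg _))
    have hall : ∀ x, ev (pt - MvPolynomial.C α * p) (x, w) = 0 := by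
      apply slice_zero_of_eventually _ w 0
      filter_upwards [Metric.ball_mem_nhds (0:ℂ) one_pos] with x hx
      have := hEq hx
      simp only [Function.const, hv] at this
      rw [rif, div_eq_iff (hne x (by simpa using hx))] at this
      simp only [ev] at this ⊢
      simp [this]
    have hall' : ∀ x, ev pt (x, w) = α * ev p (x, w) := by
      intro x
      have := hall x
      simp only [ev, map_sub, map_mul, MvPolynomial.eval_C] at this ⊢
      exact sub_eq_zero.1 this
    apply hgen
    refine ⟨w, hw1, Or.inr ?_⟩
    rintro ⟨x, y⟩ ⟨hx, hy⟩
    simp only at hx hy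
    subst hy
    have hx0 : x ≠ 0 := norm_ne_zero_iff.1 (by rw [hx]; exact one_ne_zero)
    have hder : HasDerivAt (fun t : ℝ => x * Complex.exp (t * Complex.I)) (x * Complex.I) 0 := by
      have h1 : HasDerivAt (fun t : ℂ => x * Complex.exp (t * Complex.I))
          (x * (Complex.exp (0 * Complex.I) * (1 * Complex.I))) 0 :=
        (((hasDerivAt_id (0:ℂ)).mul_const Complex.I).cexp).const_mul x
      have h2 := HasDerivAt.comp_ofReal (z := 0) (by simpa using h1)
      simpa using h2
    have ht := hder.tendsto_nhdsNE (mul_ne_zero hx0 Complex.I_ne_zero)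
    simp only [Complex.ofReal_zero, zero_mul, Complex.exp_zero, mul_one] at ht
    have hmem : ∀ᶠ t : ℝ in 𝓝[≠] 0, (x * Complex.exp (t * Complex.I), y) ∈ levelSet2 p pt α := by
      filter_upwards [ht.eventually (slice_ev_ne hR y hw x)] with t htt
      refine mem_level ⟨?_, hw1⟩ htt (hall' _)
      simp [hx, Complex.norm_exp_ofReal_mul_I]
    have hclosed : IsClosed (levelSet2 p pt α) := isClosed_closure
    exact hclosed.mem_of_tendsto
      ((ht.mono_right nhdsWithin_le_nhds).prodMk_nhds tendsto_const_nhds) hmem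

lemma core {m n : ℕ} {p pt : MvPolynomial (Fin 2) ℂ} (hR : IsRIF2 m n p pt) {α : ℂ}
    (hα : ‖α‖ = 1) (hgen : IsGenericValue p pt α) :
    ∃ q s : MvPolynomial (Fin 2) ℂ, (∀ z ∈ closedBidisk, ev s z ≠ 0) ∧
      ∀ ζ ∈ levelSet2 p pt α, (starRingEnd ℂ) ζ.1 = ev q ζ / ev s ζ := by
  obtain ⟨g, hg⟩ := dvd_sub_slice0 (pt - MvPolynomial.C α * p)
  set s := MvPolynomial.aeval ![(0 : MvPolynomial (Fin 2) ℂ), MvPolynomial.X 1] (pt - MvPolynomial.C α * p) with hs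
  have hsv : ∀ z ∈ closedBidisk, ev s z ≠ 0 := by
    intro z hz hzero
    rw [hs, ev_aeval] at hzero
    apply const_ne hR hα hgen z.2 hz.2
    simpa [ev, sub_eq_zero] using hzero
  refine ⟨-g, s, hsv, ?_⟩
  intro ζ hζ
  obtain ⟨ht, hq⟩ := level_sub hR hζ
  have hs0 := hsv ζ ⟨ht.1.le, ht.2.le⟩
  have h1 := congrArg (fun Q => ev Q ζ) hg
  simp only [ev, map_sub, map_mul, MvPolynomial.eval_C, MvPolynomial.eval_X, map_neg,
    Matrix.cons_val_zero] at h1 hq hs0 ⊢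
  have hx0 : ζ.1 ≠ 0 := norm_ne_zero_iff.1 (by rw [ht.1]; exact one_ne_zero)
  rw [← Complex.inv_eq_conj ht.1, eq_div_iff hs0, inv_mul_eq_iff_eq_mul₀ hx0]
  linear_combination hq - h1

def sw : MvPolynomial (Fin 2) ℂ ≃ₐ[ℂ] MvPolynomial (Fin 2) ℂ :=
  MvPolynomial.renameEquiv ℂ (Equiv.swap 0 1)

lemma ev_sw (p : MvPolynomial (Fin 2) ℂ) (z : ℂ × ℂ) : ev (sw p) z = ev p (z.2, z.1) := by
  unfold ev sw
  rw [MvPolynomial.renameEquiv_apply, MvPolynomial.eval_rename]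
  congr 2
  ext i; fin_cases i <;> simp

lemma sw_RIF {m n : ℕ} {p pt : MvPolynomial (Fin 2) ℂ} (hR : IsRIF2 m n p pt) :
    IsRIF2 n m (sw p) (sw pt) where
  hm := hR.hn
  hn := hR.hm
  deg1 := by
    have := MvPolynomial.degreeOf_rename_of_injective (p := p)
      (Equiv.swap (0 : Fin 2) 1).injective 1
    rw [Equiv.swap_apply_right] at this
    rw [← hR.deg2, ← this]; rfl
  deg2 := by
    have := MvPolynomial.degreeOf_rename_of_injective (p := p)
      (Equiv.swap (0 : Fin 2) 1).injective 0
    rw [Equiv.swap_apply_left] at this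
    rw [← hR.deg1, ← this]; rfl
  stable := fun z hz => by rw [ev_sw]; exact hR.stable _ ⟨hz.2, hz.1⟩
  coprime := fun r h1 h2 => by
    have a1 := map_dvd sw.symm h1
    have a2 := map_dvd sw.symm h2
    rw [AlgEquiv.symm_apply_apply] at a1 a2
    have := (hR.coprime _ a1 a2).map sw
    rwa [AlgEquiv.apply_symm_apply] at this
  reflection := fun z h1 h2 => by
    rw [ev_sw, ev_sw, hR.reflection (z.2, z.1) h2 h1]
    ring

lemma sw_level {p pt : MvPolynomial (Fin 2) ℂ} {α : ℂ} (z : ℂ × ℂ) :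
    z ∈ levelSet2 (sw p) (sw pt) α ↔ (z.2, z.1) ∈ levelSet2 p pt α := by
  have h := (Homeomorph.prodComm ℂ ℂ).preimage_closure {ζ | ζ ∈ torus2 ∧
    Tendsto (fun r : ℝ => rif p pt ((r : ℂ) * ζ.1, (r : ℂ) * ζ.2))
      (𝓝[<] (1 : ℝ)) (𝓝 α)}
  have h2 : levelSet2 (sw p) (sw pt) α =
    (Homeomorph.prodComm ℂ ℂ) ⁻¹' (levelSet2 p pt α) := by
    unfold levelSet2
    rw [h]
    congr 1
    ext ζ
    simp only [rif, ev_sw, Set.mem_ofPred_eq, Set.mem_preimage, torus2, Homeomorph.coe_prodComm,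
      Prod.fst_swap, Prod.snd_swap]
    tauto
  rw [h2]; rfl

lemma sw_gen {p pt : MvPolynomial (Fin 2) ℂ} {α : ℂ} (hgen : IsGenericValue p pt α) :
    IsGenericValue (sw p) (sw pt) α := by
  rintro ⟨τ, hτ, h | h⟩
  · refine hgen ⟨τ, hτ, Or.inr fun z hz => ?_⟩
    exact (sw_level (z.2, z.1)).1 (h ⟨hz.2, hz.1⟩)
  · refine hgen ⟨τ, hτ, Or.inl fun z hz => ?_⟩
    exact (sw_level (z.2, z.1)).1 (h ⟨hz.2, hz.1⟩)

/-- Let `φ = p̃/p` be a bidegree `(m,n)` RIF on `𝔻²` and let `α ∈ 𝕋`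
be a generic value for `φ`. Then there exist rational functions `R₁, R₂` in the bidisk
algebra `A(𝔻²)` (holomorphic on `𝔻²`, continuous on the closed bidisk) with
`conj(ζ₁) = R₁(ζ)` and `conj(ζ₂) = R₂(ζ)` on `C_α(φ)`. -/
theorem conjugate_coordinates_rational_on_levelSet
    (m n : ℕ) (p pt : MvPolynomial (Fin 2) ℂ) (hRIF : IsRIF2 m n p pt)
    (α : ℂ) (hα : ‖α‖ = 1) (hgen : IsGenericValue p pt α) :
    ∃ q₁ s₁ q₂ s₂ : MvPolynomial (Fin 2) ℂ,
      (∀ z ∈ closedBidisk, ev s₁ z ≠ 0 ∧ ev s₂ z ≠ 0) ∧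
      ContinuousOn (fun z => ev q₁ z / ev s₁ z) closedBidisk ∧
      DifferentiableOn ℂ (fun z => ev q₁ z / ev s₁ z) bidisk ∧
      ContinuousOn (fun z => ev q₂ z / ev s₂ z) closedBidisk ∧
      DifferentiableOn ℂ (fun z => ev q₂ z / ev s₂ z) bidisk ∧
      ∀ ζ ∈ levelSet2 p pt α,
        (starRingEnd ℂ) ζ.1 = ev q₁ ζ / ev s₁ ζ ∧
        (starRingEnd ℂ) ζ.2 = ev q₂ ζ / ev s₂ ζ := by
  obtain ⟨q₁, s₁, h1, h1'⟩ := core hRIF hα hgen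
  obtain ⟨q₂, s₂, h2, h2'⟩ := core (sw_RIF hRIF) hα (sw_gen hgen)
  have h3 : ∀ z ∈ closedBidisk, ev (sw s₂) z ≠ 0 := fun z hz => by
    rw [ev_sw]; exact h2 _ ⟨hz.2, hz.1⟩
  have hsub : bidisk ⊆ closedBidisk := fun z hz => ⟨hz.1.le, hz.2.le⟩
  refine ⟨q₁, s₁, sw q₂, sw s₂, fun z hz => ⟨h1 z hz, h3 z hz⟩, ?_, ?_, ?_, ?_, ?_⟩
  · exact (ev_continuous _).continuousOn.div (ev_continuous _).continuousOn h1
  · exact quot_diff (ev_differentiable _) (ev_differentiable _)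
      fun z hz => h1 z (hsub hz)
  · exact (ev_continuous _).continuousOn.div (ev_continuous _).continuousOn h3
  · exact quot_diff (ev_differentiable _) (ev_differentiable _)
      fun z hz => h3 z (hsub hz)
  · intro ζ hζ
    refine ⟨h1' ζ hζ, ?_⟩
    rw [ev_sw, ev_sw]
    exact h2' (ζ.2, ζ.1) ((sw_level _).2 hζ)
end
end
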